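/- Let (R,m) be a Noetherian complete local ring with infinite residue class field and M a finitely generated R-module with d = dim_R M = dim R ≥ 1. Then for every system of parameters x = {x_1,…,x_d} of R, the first partial Euler characteristic satisfies χ_1(x;M) ≤ hdeg_Q(M) − e_0(Q,M), where Q = (x_1,…,x_d). -/

import Mathlib

open IsLocalRing

section Defs

variable (R : Type) [CommRing R]

/-- The length of a module, as the Krull dimension of its lattice of submodules. -/
noncomputable def mLength (M : Type) [AddCommGroup M] [Module R M] : WithBot ℕ∞ :=
  Order.krullDim (Submodule R M)

/-- The (Krull) dimension of a module. -/
noncomputable def mDim (M : Type) [AddCommGroup M] [Module R M] : WithBot ℕ∞ :=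
  ringKrullDim (R ⧸ Submodule.annihilator (⊤ : Submodule R M))

/-- `f` is eventually given by the Hilbert-type polynomial of degree `t` with
coefficients `s 0, …, s t` (written in the binomial basis with alternating signs). -/
def IsHilbPolyAt (f : ℕ → WithBot ℕ∞) (t : ℕ) (s : ℕ → ℤ) : Prop :=
  ∃ N : ℕ, ∀ n ≥ N, ∃ l : ℕ, f n = (l : ℕ∞) ∧
    (l : ℤ) = ∑ i ∈ Finset.range (t + 1), (-1 : ℤ) ^ i * s i * ((n + t - i).choose (t - i) : ℤ)

/-- `s 0, …, s t` are the Hilbert coefficients `e_i(I, M)`, i.e.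
`λ(M/I^{n+1}M) = ∑ (-1)^i e_i(I,M) C(n+t-i, t-i)` for `n ≫ 0`. -/
def HasHilbCoeffs (I : Ideal R) (M : Type) [AddCommGroup M] [Module R M]
    (t : ℕ) (s : ℕ → ℤ) : Prop :=
  IsHilbPolyAt (fun n => mLength R (M ⧸ (I ^ (n + 1) • (⊤ : Submodule R M)))) t s

/-- The unmixed component `U_M(0)` of `M`: the largest submodule of dimension `< dim M`. -/
noncomputable def unmixedComp (M : Type) [AddCommGroup M] [Module R M] : Submodule R M :=
  sSup {N : Submodule R M | mDim R ↥N < mDim R M}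

/-- `x` is a d-sequence on `M`. -/
def IsDSeq {r : ℕ} (x : Fin r → R) (M : Type) [AddCommGroup M] [Module R M] : Prop :=
  ∀ i j : Fin r, i ≤ j →
    Submodule.comap (LinearMap.lsmul R M (x i * x j))
        (Ideal.span (x '' {k | k < i}) • (⊤ : Submodule R M))
      = Submodule.comap (LinearMap.lsmul R M (x j))
        (Ideal.span (x '' {k | k < i}) • (⊤ : Submodule R M))

/-- `x` is a standard (d⁺-) system: all power sequences in any order are d-sequences. -/
def IsStandardSeq {r : ℕ} (x : Fin r → R) (M : Type) [AddCommGroup M] [Module R M] : Prop :=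
  ∀ n : Fin r → ℕ, (∀ k, 1 ≤ n k) → ∀ σ : Equiv.Perm (Fin r),
    IsDSeq R (fun k => x (σ k) ^ n (σ k)) M

/-- The integral closure of an ideal, as a set. -/
def intClos (Q : Ideal R) : Set R :=
  {x : R | ∃ n : ℕ, 0 < n ∧ ∃ a : ℕ → R, (∀ i, 1 ≤ i → i ≤ n → a i ∈ Q ^ i) ∧
    x ^ n + ∑ i ∈ Finset.Icc 1 n, a i * x ^ (n - i) = 0}

variable [IsLocalRing R]

/-- `h ∈ I` is superficial for `M` with respect to `I`. -/
def IsSuperficial (I : Ideal R) (M : Type) [AddCommGroup M] [Module R M] (h : R) : Prop :=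
  h ∈ I ∧ ∃ c N : ℕ, ∀ n ≥ N,
    Submodule.comap (LinearMap.lsmul R M h) (I ^ (n + 1) • (⊤ : Submodule R M))
        ⊓ (I ^ c • (⊤ : Submodule R M))
      = I ^ n • (⊤ : Submodule R M)

/-- `Q` is a parameter ideal for `M` (`r` the dimension of `M`):
generated by `r` elements of the maximal ideal with `M/QM` of finite length. -/
def IsParamIdeal (Q : Ideal R) (M : Type) [AddCommGroup M] [Module R M] (r : ℕ) : Prop :=
  Q ≤ maximalIdeal R ∧ (∃ x : Fin r → R, Q = Ideal.span (Set.range x)) ∧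
    IsFiniteLength R (M ⧸ Q • (⊤ : Submodule R M))

/-- Local cohomology `H^i_𝔪(M)` with support in the maximal ideal. -/
noncomputable def LC (i : ℕ) (M : Type) [AddCommGroup M] [Module R M] : ModuleCat R :=
  (localCohomology (maximalIdeal R) i).obj (ModuleCat.of R M)

/-- `M` is Cohen–Macaulay: there is a regular sequence on `M` in the maximal ideal
whose length equals `dim M`. -/
def IsCM (M : Type) [AddCommGroup M] [Module R M] : Prop :=
  ∃ rs : List R, (∀ x ∈ rs, x ∈ maximalIdeal R) ∧ RingTheory.Sequence.IsRegular M rs ∧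
    (rs.length : WithBot ℕ∞) = mDim R M

/-- `M` is unmixed: `dim R̂/p = dim M` for every associated prime `p` of the completion `M̂`. -/
def IsUnmixed (M : Type) [AddCommGroup M] [Module R M] : Prop :=
  ∀ p ∈ associatedPrimes (AdicCompletion (maximalIdeal R) R)
      (AdicCompletion (maximalIdeal R) M),
    ringKrullDim ((AdicCompletion (maximalIdeal R) R) ⧸ p) = mDim R M

/-- `M` is generalized Cohen–Macaulay: `H^i_𝔪(M)` has finite length for `i < r = dim M`. -/
def IsGenCM (M : Type) [AddCommGroup M] [Module R M] (r : ℕ) : Prop :=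
  ∀ i < r, IsFiniteLength R ↥(LC R i M)

/-- The set `Λ(M)` of first Hilbert coefficients of parameter ideals for `M`. -/
def Lambda (M : Type) [AddCommGroup M] [Module R M] (r : ℕ) : Set ℤ :=
  {a : ℤ | ∃ (Q : Ideal R) (e : ℕ → ℤ),
    IsParamIdeal R Q M r ∧ HasHilbCoeffs R Q M r e ∧ e 1 = a}

/-- A standard parameter ideal: one generated by a standard system of parameters. -/
def IsStandardParamIdeal (Q : Ideal R) (M : Type) [AddCommGroup M] [Module R M]
    (r : ℕ) : Prop :=
  IsParamIdeal R Q M r ∧ ∃ x : Fin r → R, Q = Ideal.span (Set.range x) ∧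
    IsStandardSeq R x M

/-- `M` is Buchsbaum: every parameter ideal for `M` is standard. -/
def IsBuchsbaum (M : Type) [AddCommGroup M] [Module R M] (r : ℕ) : Prop :=
  ∀ Q : Ideal R, IsParamIdeal R Q M r → IsStandardParamIdeal R Q M r

/-- `M` is a Vasconcelos module. -/
def IsVasconcelos (M : Type) [AddCommGroup M] [Module R M] : Prop :=
  mDim R M ≤ 0 ∨ (0 < mDim R M ∧ ∃ (r : ℕ) (Q : Ideal R) (e : ℕ → ℤ),
    mDim R M = (r : ℕ∞) ∧ IsParamIdeal R Q M r ∧ HasHilbCoeffs R Q M r e ∧ e 1 = 0)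

/-- A Gorenstein local ring: Noetherian, Cohen–Macaulay, with an irreducible parameter ideal. -/
def IsGorensteinLocalRing : Prop :=
  IsNoetherianRing R ∧ IsCM R R ∧ ∃ (r : ℕ) (Q : Ideal R),
    mDim R R = (r : ℕ∞) ∧ IsParamIdeal R Q R r ∧
    ∀ I J : Ideal R, Q = I ⊓ J → Q = I ∨ Q = J

/-- `E` is an injective envelope of the residue field `R/𝔪`. -/
def IsInjEnvResidue (E : Type) [AddCommGroup E] [Module R E] : Prop :=
  Module.Injective R E ∧ ∃ ι : (R ⧸ maximalIdeal R) →ₗ[R] E, Function.Injective ι ∧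
    ∀ N : Submodule R E, N ⊓ LinearMap.range ι = ⊥ → N = ⊥

end Defs

/-- A (not necessarily local) Cohen–Macaulay ring: Noetherian,
with all localizations at primes Cohen–Macaulay. -/
def IsCMRing (S : Type) [CommRing S] : Prop :=
  IsNoetherianRing S ∧ ∀ (p : Ideal S) [p.IsPrime],
    IsCM (Localization.AtPrime p) (Localization.AtPrime p)

/-- A (not necessarily local) Gorenstein ring. -/
def IsGorensteinRing (S : Type) [CommRing S] : Prop :=
  IsNoetherianRing S ∧ ∀ (p : Ideal S) [p.IsPrime],
    IsGorensteinLocalRing (Localization.AtPrime p)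

/-- `HDegRel R I E M v` : `v` is the homological degree `hdeg_I(M)` computed
with Matlis duals taken relative to `E`. -/
inductive HDegRel (R : Type) [CommRing R] [IsLocalRing R] (I : Ideal R)
    (E : Type) [AddCommGroup E] [Module R E] : ModuleCat R → ℕ → Prop where
  | base : ∀ (M : ModuleCat R) (l : ℕ), mDim R M ≤ 0 → mLength R M = (l : ℕ∞) →
      HDegRel R I E M l
  | step : ∀ (M : ModuleCat R) (r : ℕ), mDim R M = (r : ℕ∞) → 0 < r →
      ∀ (e : ℕ → ℤ) (e0 : ℕ), HasHilbCoeffs R I M r e → e 0 = (e0 : ℤ) →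
      ∀ v : ℕ → ℕ,
        (∀ j < r, HDegRel R I E (ModuleCat.of R ((LC R j M) →ₗ[R] E)) (v j)) →
      HDegRel R I E M (e0 + ∑ j ∈ Finset.range r, (r - 1).choose j * v j)

section HomologicalAlgebra

open CategoryTheory Limits

lemma comp_comp_zero_of_comp_zero {C : Type*} [Category C] [HasZeroMorphisms C] {W X Y Z : C}
    {f : W ⟶ X} {g : X ⟶ Y} (h : f ≫ g = 0) (k : Y ⟶ Z) : f ≫ g ≫ k = 0 := by
  rw [← Category.assoc, h, zero_comp]

section LeftDerivedLES

universe v₁ v₂ u₁ u₂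

variable {C : Type u₁} [Category.{v₁} C] [Abelian C] [EnoughProjectives C]
  {D : Type u₂} [Category.{v₂} D] [Abelian D]
  {F₁ F₂ F₃ : C ⥤ D} [F₁.Additive] [F₂.Additive] [F₃.Additive]

/-- The image of a complex under an additive functor. -/
noncomputable abbrev mapChain (F : C ⥤ D) [F.Additive] (P : ChainComplex C ℕ) :
    ChainComplex D ℕ :=
  (F.mapHomologicalComplex _).obj P

/-- The image of a map of complexes under an additive functor. -/
noncomputable abbrev mapChainMap (F : C ⥤ D) [F.Additive] {P Q : ChainComplex C ℕ} (φ : P ⟶ Q) :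
    mapChain F P ⟶ mapChain F Q :=
  (F.mapHomologicalComplex _).map φ

/-- The map of complexes induced by a natural transformation. -/
noncomputable abbrev natChain (α : F₁ ⟶ F₂) (P : ChainComplex C ℕ) :
    mapChain F₁ P ⟶ mapChain F₂ P :=
  (NatTrans.mapHomologicalComplex α _).app P

/-- Left derived functors computed by a projective resolution. -/
noncomputable def leftDerivedIso (F : C ⥤ D) [F.Additive] {X : C} (P : ProjectiveResolution X)
    (n : ℕ) : (F.leftDerived n).obj X ≅ (mapChain F P.complex).homology n :=
  P.isoLeftDerivedObj F n

lemma leftDerivedIso_naturality (F : C ⥤ D) [F.Additive] {X Y : C} (f : X ⟶ Y)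
    (P : ProjectiveResolution X) (Q : ProjectiveResolution Y) (n : ℕ) :
    (F.leftDerived n).map f ≫ (leftDerivedIso F Q n).hom =
      (leftDerivedIso F P n).hom ≫
        HomologicalComplex.homologyMap (mapChainMap F (ProjectiveResolution.lift f P Q)) n :=
  ProjectiveResolution.isoLeftDerivedObj_hom_naturality f P Q _
    (ProjectiveResolution.lift_commutes_zero f P Q) F n

lemma leftDerivedIso_inv_naturality (F : C ⥤ D) [F.Additive] {X Y : C} (f : X ⟶ Y)
    (P : ProjectiveResolution X) (Q : ProjectiveResolution Y) (n : ℕ) :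
    (leftDerivedIso F P n).inv ≫ (F.leftDerived n).map f =
        HomologicalComplex.homologyMap (mapChainMap F (ProjectiveResolution.lift f P Q)) n ≫
          (leftDerivedIso F Q n).inv :=
  ProjectiveResolution.isoLeftDerivedObj_inv_naturality f P Q _
    (ProjectiveResolution.lift_commutes_zero f P Q) F n

lemma leftDerivedIso_naturality_assoc (F : C ⥤ D) [F.Additive] {X Y : C} (f : X ⟶ Y)
    (P : ProjectiveResolution X) (Q : ProjectiveResolution Y) (n : ℕ) {Z : D}
    (k : (mapChain F Q.complex).homology n ⟶ Z) :
    (F.leftDerived n).map f ≫ (leftDerivedIso F Q n).hom ≫ k =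
      (leftDerivedIso F P n).hom ≫
        HomologicalComplex.homologyMap (mapChainMap F (ProjectiveResolution.lift f P Q)) n ≫ k := by
  rw [← Category.assoc, leftDerivedIso_naturality, Category.assoc]

lemma leftDerived_app_eq (α : F₁ ⟶ F₂) {X : C} (P : ProjectiveResolution X) (n : ℕ) :
    (NatTrans.leftDerived α n).app X = (leftDerivedIso F₁ P n).hom ≫
      HomologicalComplex.homologyMap (natChain α P.complex) n ≫ (leftDerivedIso F₂ P n).inv :=
  ProjectiveResolution.leftDerived_app_eq α P n

variable (α : F₁ ⟶ F₂) (β : F₂ ⟶ F₃) (w : α ≫ β = 0)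

omit [EnoughProjectives C] in
include w in
lemma natChain_comp (P : ChainComplex C ℕ) : natChain α P ≫ natChain β P = 0 := by
  ext i
  exact congr_app w (P.X i)

/-- The short complex of chain complexes obtained by evaluating two composable natural
transformations on a chain complex. -/
noncomputable abbrev chainShortComplex (w : α ≫ β = 0) (P : ChainComplex C ℕ) :
    ShortComplex (ChainComplex D ℕ) :=
  ShortComplex.mk (natChain α P) (natChain β P) (natChain_comp α β w P)

/-- A short exact sequence of functors (exact on projective objects). -/
def ExactOnProjectives (w : α ≫ β = 0) : Prop :=
  ∀ X : C, Projective X →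
    (ShortComplex.mk (α.app X) (β.app X) (by exact congr_app w X)).ShortExact

variable {α β w}

omit [EnoughProjectives C] in
lemma ExactOnProjectives.shortExact (h : ExactOnProjectives α β w) {X : C}
    (P : ProjectiveResolution X) : (chainShortComplex α β w P.complex).ShortExact :=
  HomologicalComplex.shortExact_of_degreewise_shortExact _ fun i => h _ (P.projective i)

/-- The functoriality of `chainShortComplex` in the complex. -/
noncomputable def chainShortComplexMap {P Q : ChainComplex C ℕ} (φ : P ⟶ Q) :
    chainShortComplex α β w P ⟶ chainShortComplex α β w Q where
  τ₁ := mapChainMap F₁ φ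
  τ₂ := mapChainMap F₂ φ
  τ₃ := mapChainMap F₃ φ
  comm₁₂ := (NatTrans.mapHomologicalComplex α _).naturality φ
  comm₂₃ := (NatTrans.mapHomologicalComplex β _).naturality φ

/-- The connecting morphism of the homology sequence of `chainShortComplex`. -/
noncomputable def chainδ (h : ExactOnProjectives α β w) {X : C} (P : ProjectiveResolution X)
    (n : ℕ) : (mapChain F₃ P.complex).homology (n + 1) ⟶ (mapChain F₁ P.complex).homology n :=
  (h.shortExact P).δ (n + 1) n rfl

omit [EnoughProjectives C] in
lemma chainδ_naturality (h : ExactOnProjectives α β w) {X Y : C} (P : ProjectiveResolution X)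
    (Q : ProjectiveResolution Y) (φ : P.complex ⟶ Q.complex) (n : ℕ) :
    chainδ h P n ≫ HomologicalComplex.homologyMap (mapChainMap F₁ φ) n =
      HomologicalComplex.homologyMap (mapChainMap F₃ φ) (n + 1) ≫ chainδ h Q n :=
  HomologicalComplex.HomologySequence.δ_naturality
      (chainShortComplexMap (α := α) (β := β) (w := w) φ) (h.shortExact _) (h.shortExact _)
      (n + 1) n rfl

omit [EnoughProjectives C] in
lemma chainδ_naturality_assoc (h : ExactOnProjectives α β w) {X Y : C}
    (P : ProjectiveResolution X) (Q : ProjectiveResolution Y) (φ : P.complex ⟶ Q.complex) (n : ℕ)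
    {Z : D} (k : (mapChain F₁ Q.complex).homology n ⟶ Z) :
    chainδ h P n ≫ HomologicalComplex.homologyMap (mapChainMap F₁ φ) n ≫ k =
      HomologicalComplex.homologyMap (mapChainMap F₃ φ) (n + 1) ≫ chainδ h Q n ≫ k := by
  rw [← Category.assoc, chainδ_naturality, Category.assoc]

/-- The connecting morphism for left derived functors. -/
noncomputable def leftDerivedδ (h : ExactOnProjectives α β w) (n : ℕ) :
    F₃.leftDerived (n + 1) ⟶ F₁.leftDerived n where
  app X := (leftDerivedIso F₃ (projectiveResolution X) (n + 1)).hom ≫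
    chainδ h (projectiveResolution X) n ≫
      (leftDerivedIso F₁ (projectiveResolution X) n).inv
  naturality X Y f := by
    rw [leftDerivedIso_naturality_assoc F₃ f (projectiveResolution X) (projectiveResolution Y),
      Category.assoc, Category.assoc,
      leftDerivedIso_inv_naturality F₁ f (projectiveResolution X) (projectiveResolution Y),
      chainδ_naturality_assoc]

lemma leftDerivedδ_app (h : ExactOnProjectives α β w) (n : ℕ) (X : C) :
    (leftDerivedδ h n).app X = (leftDerivedIso F₃ (projectiveResolution X) (n + 1)).hom ≫
    chainδ h (projectiveResolution X) n ≫
      (leftDerivedIso F₁ (projectiveResolution X) n).inv := rfl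

lemma leftDerived_exact₂ (h : ExactOnProjectives α β w) (n : ℕ) (X : C) :
    ∃ w', (ShortComplex.mk ((NatTrans.leftDerived α n).app X)
      ((NatTrans.leftDerived β n).app X) w').Exact := by
  let P := projectiveResolution X
  have w₀ : HomologicalComplex.homologyMap (natChain α P.complex) n ≫
      HomologicalComplex.homologyMap (natChain β P.complex) n = 0 := by
    rw [← HomologicalComplex.homologyMap_comp, natChain_comp α β w,
      HomologicalComplex.homologyMap_zero]
  have w' : (NatTrans.leftDerived α n).app X ≫ (NatTrans.leftDerived β n).app X = 0 := by
    rw [leftDerived_app_eq α P, leftDerived_app_eq β P]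
    simp [comp_comp_zero_of_comp_zero w₀]
  have ex : (ShortComplex.mk _ _ w₀).Exact := (h.shortExact P).homology_exact₂ n
  refine ⟨w', (ShortComplex.exact_iff_of_iso ?_).1 ex⟩
  exact ShortComplex.isoMk (leftDerivedIso F₁ P n).symm (leftDerivedIso F₂ P n).symm
    (leftDerivedIso F₃ P n).symm (by simp [leftDerived_app_eq α P])
    (by simp [leftDerived_app_eq β P])

lemma leftDerived_exact₃ (h : ExactOnProjectives α β w) (n : ℕ) (X : C) :
    ∃ w', (ShortComplex.mk ((NatTrans.leftDerived β (n + 1)).app X)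
      ((leftDerivedδ h n).app X) w').Exact := by
  let P := projectiveResolution X
  have w₀ : HomologicalComplex.homologyMap (natChain β P.complex) (n + 1) ≫
      chainδ h P n = 0 := (h.shortExact P).comp_δ _ _ _
  have w' : (NatTrans.leftDerived β (n + 1)).app X ≫ (leftDerivedδ h n).app X = 0 := by
    rw [leftDerived_app_eq β P, leftDerivedδ_app]
    simp [P, comp_comp_zero_of_comp_zero w₀]
  have ex : (ShortComplex.mk _ _ w₀).Exact := (h.shortExact P).homology_exact₃ (n + 1) n rfl
  refine ⟨w', (ShortComplex.exact_iff_of_iso ?_).1 ex⟩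
  exact ShortComplex.isoMk (leftDerivedIso F₂ P (n + 1)).symm (leftDerivedIso F₃ P (n + 1)).symm
    (leftDerivedIso F₁ P n).symm (by simp [leftDerived_app_eq β P])
    (by simp [leftDerivedδ_app, P])

lemma leftDerived_exact₁ (h : ExactOnProjectives α β w) (n : ℕ) (X : C) :
    ∃ w', (ShortComplex.mk ((leftDerivedδ h n).app X)
      ((NatTrans.leftDerived α n).app X) w').Exact := by
  let P := projectiveResolution X
  have w₀ : chainδ h P n ≫ HomologicalComplex.homologyMap (natChain α P.complex) n = 0 :=
    (h.shortExact P).δ_comp _ _ _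
  have w' : (leftDerivedδ h n).app X ≫ (NatTrans.leftDerived α n).app X = 0 := by
    rw [leftDerived_app_eq α P, leftDerivedδ_app]
    simp [P, comp_comp_zero_of_comp_zero w₀]
  have ex : (ShortComplex.mk _ _ w₀).Exact := (h.shortExact P).homology_exact₁ (n + 1) n rfl
  refine ⟨w', (ShortComplex.exact_iff_of_iso ?_).1 ex⟩
  exact ShortComplex.isoMk (leftDerivedIso F₃ P (n + 1)).symm (leftDerivedIso F₁ P n).symm
    (leftDerivedIso F₂ P n).symm (by simp [leftDerivedδ_app, P])
    (by simp [leftDerived_app_eq α P])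

end LeftDerivedLES

section ExtLES

variable {R : Type} [CommRing R]

/-- The functor `Hom(-, Y)` with values in the opposite category. -/
noncomputable abbrev homInto (Y : ModuleCat.{0} R) : ModuleCat.{0} R ⥤ (ModuleCat.{0} R)ᵒᵖ :=
  ((linearYoneda R (ModuleCat.{0} R)).obj Y).rightOp

/-- The natural transformation induced by a morphism in the second variable of `Hom`. -/
noncomputable abbrev homIntoMap {Y Y' : ModuleCat.{0} R} (f : Y ⟶ Y') : homInto Y' ⟶ homInto Y :=
  NatTrans.rightOp ((linearYoneda R (ModuleCat.{0} R)).map f)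

lemma comp_comp_eq_zero {X Y₁ Y₂ Y₃ : ModuleCat.{0} R} (φ : X ⟶ Y₁) {f : Y₁ ⟶ Y₂} {g : Y₂ ⟶ Y₃}
    (w : f ≫ g = 0) : (φ ≫ f) ≫ g = 0 := by
  rw [Category.assoc, w, comp_zero]

lemma homIntoMap_comp_eq_zero {Y₁ Y₂ Y₃ : ModuleCat.{0} R} {f : Y₁ ⟶ Y₂} {g : Y₂ ⟶ Y₃}
    (w : f ≫ g = 0) : homIntoMap g ≫ homIntoMap f = 0 := by
  ext X
  apply Quiver.Hom.unop_inj
  ext φ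
  exact comp_comp_eq_zero φ w

lemma exactOnProjectives_homInto {S : ShortComplex (ModuleCat.{0} R)} (hS : S.ShortExact) :
    ExactOnProjectives (homIntoMap S.g) (homIntoMap S.f) (homIntoMap_comp_eq_zero S.zero) := by
  intro X hX
  have key : (ShortComplex.mk (((linearYoneda R (ModuleCat.{0} R)).map S.f).app (Opposite.op X))
      (((linearYoneda R (ModuleCat.{0} R)).map S.g).app (Opposite.op X)) (by
        ext φ
        exact comp_comp_eq_zero φ S.zero)).ShortExact := by
    have := hS.mono_f
    have := hS.epi_g
    refine ShortComplex.ShortExact.mk' ?_ ?_ ?_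
    · rw [ShortComplex.moduleCat_exact_iff]
      intro (φ : X ⟶ S.X₂) (hφ : φ ≫ S.g = 0)
      exact ⟨hS.exact.lift φ hφ, hS.exact.lift_f φ hφ⟩
    · rw [ModuleCat.mono_iff_injective]
      intro (φ : X ⟶ S.X₁) (ψ : X ⟶ S.X₁) (h : φ ≫ S.f = ψ ≫ S.f)
      exact (cancel_mono S.f).1 h
    · rw [ModuleCat.epi_iff_surjective]
      intro (φ : X ⟶ S.X₃)
      exact ⟨Projective.factorThru φ S.g, Projective.factorThru_comp φ S.g⟩
  exact key.op

/-- `Ext` as a module. -/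
noncomputable abbrev extObj (n : ℕ) (X Y : ModuleCat.{0} R) : ModuleCat.{0} R :=
  ((Ext R (ModuleCat.{0} R) n).obj (Opposite.op X)).obj Y

/-- The connecting map of `Ext`, natural in the first variable. -/
noncomputable def extδ {S : ShortComplex (ModuleCat.{0} R)} (hS : S.ShortExact) (n : ℕ)
    (X : ModuleCat.{0} R) : extObj n X S.X₃ ⟶ extObj (n + 1) X S.X₁ :=
  ((leftDerivedδ (exactOnProjectives_homInto hS) n).app X).unop

lemma extδ_naturality {S : ShortComplex (ModuleCat.{0} R)} (hS : S.ShortExact) (n : ℕ)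
    {X X' : ModuleCat.{0} R} (f : X' ⟶ X) :
    ((Ext R (ModuleCat.{0} R) n).map f.op).app S.X₃ ≫ extδ hS n X' =
      extδ hS n X ≫ ((Ext R (ModuleCat.{0} R) (n + 1)).map f.op).app S.X₁ :=
  Quiver.Hom.op_inj ((leftDerivedδ (exactOnProjectives_homInto hS) n).naturality f).symm

lemma ext_exact₂ {S : ShortComplex (ModuleCat.{0} R)} (hS : S.ShortExact) (n : ℕ)
    (X : ModuleCat.{0} R) :
    Function.Exact (((Ext R (ModuleCat.{0} R) n).obj (Opposite.op X)).map S.f)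
      (((Ext R (ModuleCat.{0} R) n).obj (Opposite.op X)).map S.g) := by
  obtain ⟨w, h⟩ := leftDerived_exact₂ (exactOnProjectives_homInto hS) n X
  exact (ShortComplex.ShortExact.moduleCat_exact_iff_function_exact _).1 h.unop

lemma ext_exact₃ {S : ShortComplex (ModuleCat.{0} R)} (hS : S.ShortExact) (n : ℕ)
    (X : ModuleCat.{0} R) :
    Function.Exact (((Ext R (ModuleCat.{0} R) n).obj (Opposite.op X)).map S.g)
      (extδ hS n X) := by
  obtain ⟨w, h⟩ := leftDerived_exact₁ (exactOnProjectives_homInto hS) n X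
  exact (ShortComplex.ShortExact.moduleCat_exact_iff_function_exact _).1 h.unop

lemma ext_exact₁ {S : ShortComplex (ModuleCat.{0} R)} (hS : S.ShortExact) (n : ℕ)
    (X : ModuleCat.{0} R) :
    Function.Exact (extδ hS n X)
      (((Ext R (ModuleCat.{0} R) (n + 1)).obj (Opposite.op X)).map S.f) := by
  obtain ⟨w, h⟩ := leftDerived_exact₃ (exactOnProjectives_homInto hS) n X
  exact (ShortComplex.ShortExact.moduleCat_exact_iff_function_exact _).1 h.unop

end ExtLES

section ColimitExact

variable {R : Type} [CommRing R] {J : Type} [SmallCategory J] [IsFiltered J]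

lemma exact_of_isColimit {K₁ K₂ K₃ : J ⥤ ModuleCat.{0} R} {c₁ : Cocone K₁} {c₂ : Cocone K₂}
    {c₃ : Cocone K₃} (h₁ : IsColimit c₁) (h₂ : IsColimit c₂) (h₃ : IsColimit c₃) (f : K₁ ⟶ K₂)
    (g : K₂ ⟶ K₃) (F : c₁.pt ⟶ c₂.pt) (G : c₂.pt ⟶ c₃.pt)
    (hF : ∀ j, c₁.ι.app j ≫ F = f.app j ≫ c₂.ι.app j)
    (hG : ∀ j, c₂.ι.app j ≫ G = g.app j ≫ c₃.ι.app j)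
    (hex : ∀ j, Function.Exact (f.app j) (g.app j)) : Function.Exact F G := by
  have hF' : ∀ j x, F (c₁.ι.app j x) = c₂.ι.app j (f.app j x) := fun j x =>
    congr_arg (fun φ => φ.hom x) (hF j)
  have hG' : ∀ j x, G (c₂.ι.app j x) = c₃.ι.app j (g.app j x) := fun j x =>
    congr_arg (fun φ => φ.hom x) (hG j)
  intro y
  constructor
  · intro hy
    obtain ⟨j, y, rfl⟩ := Concrete.isColimit_exists_rep K₂ h₂ y
    rw [hG'] at hy
    have h0 : c₃.ι.app j (g.app j y) = c₃.ι.app j 0 := by rw [hy, map_zero]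
    obtain ⟨k, a, b, hab⟩ := Concrete.isColimit_exists_of_rep_eq K₃ h₃ _ _ h0
    rw [map_zero] at hab
    have h2 : g.app k (K₂.map a y) = 0 := by
      rw [← hab]
      exact (congr_arg (fun φ => φ.hom y) (g.naturality a))
    obtain ⟨x, hx⟩ := (hex k _).1 h2
    refine ⟨c₁.ι.app k x, ?_⟩
    rw [hF', hx]
    exact congr_arg (fun φ => φ.hom y) (c₂.w a)
  · rintro ⟨x, rfl⟩
    obtain ⟨j, x, rfl⟩ := Concrete.isColimit_exists_rep K₁ h₁ x
    rw [hF', hG', (hex j).apply_apply_eq_zero, map_zero]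

end ColimitExact

section LocalCohomology

variable {R : Type} [CommRing R] (J : Ideal R)

/-- The diagram of `Ext` functors defining local cohomology. -/
noncomputable abbrev lcDiagram (j : ℕ) : (ℕᵒᵖ)ᵒᵖ ⥤ ModuleCat.{0} R ⥤ ModuleCat.{0} R :=
  localCohomology.diagram (localCohomology.idealPowersDiagram J) j

/-- The `Ext` diagram defining the local cohomology of a given module. -/
noncomputable abbrev lcDiagramAt (j : ℕ) (M : ModuleCat.{0} R) : (ℕᵒᵖ)ᵒᵖ ⥤ ModuleCat.{0} R :=
  lcDiagram J j ⋙ (evaluation _ _).obj M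

/-- The colimit cocone with point the local cohomology of a given module. -/
noncomputable def lcCocone (j : ℕ) (M : ModuleCat.{0} R) : Cocone (lcDiagramAt J j M) :=
  ((evaluation _ _).obj M).mapCocone (colimit.cocone (lcDiagram J j))

/-- `lcCocone` is a colimit cocone. -/
noncomputable def lcIsColimit (j : ℕ) (M : ModuleCat.{0} R) : IsColimit (lcCocone J j M) :=
  isColimitOfPreserves ((evaluation _ _).obj M) (colimit.isColimit (lcDiagram J j))

/-- Local cohomology as a functor. -/
noncomputable abbrev lcObj (j : ℕ) (M : ModuleCat.{0} R) : ModuleCat.{0} R :=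
  (localCohomology J j).obj M

/-- The structure map from `Ext` to local cohomology. -/
noncomputable def lcι (j : ℕ) (M : ModuleCat.{0} R) (t : (ℕᵒᵖ)ᵒᵖ) :
    (lcDiagramAt J j M).obj t ⟶ lcObj J j M :=
  (lcCocone J j M).ι.app t

/-- The map of diagrams induced by a linear map. -/
noncomputable def lcDiagramMap (j : ℕ) {M N : ModuleCat.{0} R} (f : M ⟶ N) :
    lcDiagramAt J j M ⟶ lcDiagramAt J j N where
  app t := ((lcDiagram J j).obj t).map f
  naturality _ _ a := ((lcDiagram J j).map a).naturality f |>.symm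

lemma lcι_naturality (j : ℕ) {M N : ModuleCat.{0} R} (f : M ⟶ N) (t : (ℕᵒᵖ)ᵒᵖ) :
    lcι J j M t ≫ (localCohomology J j).map f = (lcDiagramMap J j f).app t ≫ lcι J j N t :=
  ((colimit.ι (lcDiagram J j) t).naturality f).symm

variable {S : ShortComplex (ModuleCat.{0} R)} (hS : S.ShortExact)

/-- The connecting map on diagrams. -/
noncomputable def lcDiagramδ (j : ℕ) :
    lcDiagramAt J j S.X₃ ⟶ lcDiagramAt J (j + 1) S.X₁ where
  app _ := extδ hS j _
  naturality _ _ a := extδ_naturality hS j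
    ((localCohomology.ringModIdeals (localCohomology.idealPowersDiagram J)).map a.unop)

/-- The connecting map of local cohomology. -/
noncomputable def lcδ (j : ℕ) : lcObj J j S.X₃ ⟶ lcObj J (j + 1) S.X₁ :=
  (lcIsColimit J j S.X₃).map (lcCocone J (j + 1) S.X₁) (lcDiagramδ J hS j)

lemma lcι_lcδ (j : ℕ) (t : (ℕᵒᵖ)ᵒᵖ) :
    lcι J j S.X₃ t ≫ lcδ J hS j = (lcDiagramδ J hS j).app t ≫ lcι J (j + 1) S.X₁ t :=
  (lcIsColimit J j S.X₃).ι_map (lcCocone J (j + 1) S.X₁) (lcDiagramδ J hS j) t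

include hS

lemma lc_exact₂ (j : ℕ) : Function.Exact ((localCohomology J j).map S.f)
    ((localCohomology J j).map S.g) :=
  exact_of_isColimit (lcIsColimit J j S.X₁) (lcIsColimit J j S.X₂) (lcIsColimit J j S.X₃)
    (lcDiagramMap J j S.f) (lcDiagramMap J j S.g) _ _ (lcι_naturality J j S.f)
    (lcι_naturality J j S.g) fun _ => ext_exact₂ hS j _

lemma lc_exact₃ (j : ℕ) : Function.Exact ((localCohomology J j).map S.g) (lcδ J hS j) :=
  exact_of_isColimit (lcIsColimit J j S.X₂) (lcIsColimit J j S.X₃) (lcIsColimit J (j + 1) S.X₁)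
    (lcDiagramMap J j S.g) (lcDiagramδ J hS j) _ _ (lcι_naturality J j S.g)
    (lcι_lcδ J hS j) fun _ => ext_exact₃ hS j _

lemma lc_exact₁ (j : ℕ) : Function.Exact (lcδ J hS j) ((localCohomology J (j + 1)).map S.f) :=
  exact_of_isColimit (lcIsColimit J j S.X₃) (lcIsColimit J (j + 1) S.X₁)
    (lcIsColimit J (j + 1) S.X₂) (lcDiagramδ J hS j) (lcDiagramMap J (j + 1) S.f) _ _
    (lcι_lcδ J hS j) (lcι_naturality J (j + 1) S.f) fun _ => ext_exact₁ hS j _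

end LocalCohomology

section CentralEndomorphism

universe v₁ u₁

variable {D : Type u₁} [Category.{v₁} D] [Abelian D]

/-- A natural endomorphism of the identity functor acts on homology as expected. -/
lemma homologyMap_eq_of_central (z : 𝟭 D ⟶ 𝟭 D) {K : ChainComplex D ℕ} (φ : K ⟶ K)
    (h : ∀ i, φ.f i = z.app (K.X i)) (n : ℕ) :
    HomologicalComplex.homologyMap φ n = z.app (K.homology n) := by
  have hc : HomologicalComplex.cyclesMap φ n = z.app (K.cycles n) := by
    rw [← cancel_mono (K.iCycles n), HomologicalComplex.cyclesMap_i, h]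
    exact z.naturality (K.iCycles n)
  rw [← cancel_epi (K.homologyπ n), HomologicalComplex.homologyπ_naturality, hc]
  exact (z.naturality (K.homologyπ n)).symm

end CentralEndomorphism

section LeftDerivedZero

universe v₁ v₂ u₁ u₂

variable {C : Type u₁} [Category.{v₁} C] [Abelian C] [EnoughProjectives C]
  {D : Type u₂} [Category.{v₂} D] [Abelian D]
  {F G : C ⥤ D} [F.Additive] [G.Additive]

/-- The map from the opcycles in degree zero to the value of the functor. -/
noncomputable def opcyclesToObj (F : C ⥤ D) [F.Additive] {X : C} (P : ProjectiveResolution X) :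
    (mapChain F P.complex).opcycles 0 ⟶ F.obj X :=
  P.fromLeftDerivedZero' F

omit [EnoughProjectives C] in
lemma pOpcycles_opcyclesToObj (F : C ⥤ D) [F.Additive] {X : C} (P : ProjectiveResolution X) :
    HomologicalComplex.pOpcycles (mapChain F P.complex) 0 ≫ opcyclesToObj F P =
      F.map (P.π.f 0) :=
  P.pOpcycles_comp_fromLeftDerivedZero' F

omit [EnoughProjectives C] in
lemma opcyclesToObj_comp (α : F ⟶ G) {X : C} (P : ProjectiveResolution X) :
    HomologicalComplex.opcyclesMap (natChain α P.complex) 0 ≫ opcyclesToObj G P =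
      opcyclesToObj F P ≫ α.app X := by
  rw [← cancel_epi (HomologicalComplex.pOpcycles _ _), HomologicalComplex.p_opcyclesMap_assoc,
    pOpcycles_opcyclesToObj, ← Category.assoc, pOpcycles_opcyclesToObj]
  exact (α.naturality (P.π.f 0)).symm

lemma fromLeftDerivedZero_app_eq (F : C ⥤ D) [F.Additive] {X : C} (P : ProjectiveResolution X) :
    F.fromLeftDerivedZero.app X = (leftDerivedIso F P 0).hom ≫
      (mapChain F P.complex).homologyι 0 ≫ opcyclesToObj F P :=
  P.fromLeftDerivedZero_eq F

lemma leftDerived_comp_fromLeftDerivedZero (α : F ⟶ G) (X : C) :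
    (NatTrans.leftDerived α 0).app X ≫ G.fromLeftDerivedZero.app X =
      F.fromLeftDerivedZero.app X ≫ α.app X := by
  let P := projectiveResolution X
  rw [fromLeftDerivedZero_app_eq F P, fromLeftDerivedZero_app_eq G P, leftDerived_app_eq α P,
    Category.assoc, Category.assoc, Category.assoc, Category.assoc,
    ← opcyclesToObj_comp α P, Iso.inv_hom_id_assoc, HomologicalComplex.homologyι_naturality_assoc]

end LeftDerivedZero

section LinearAction

variable {R : Type} [CommRing R]

/-- Multiplication by a scalar as an endomorphism of the identity functor of the opposite of
the category of modules. -/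
noncomputable def opScalar (a : R) : 𝟭 (ModuleCat.{0} R)ᵒᵖ ⟶ 𝟭 (ModuleCat.{0} R)ᵒᵖ where
  app X := (a • 𝟙 X.unop).op
  naturality X Y f := Quiver.Hom.unop_inj (by
    change (a • 𝟙 Y.unop) ≫ f.unop = f.unop ≫ (a • 𝟙 X.unop)
    rw [Linear.smul_comp, Linear.comp_smul, Category.id_comp, Category.comp_id])

lemma comp_smul_id (a : R) {X Y : ModuleCat.{0} R} (φ : X ⟶ Y) : φ ≫ (a • 𝟙 Y) = a • φ := by
  rw [Linear.comp_smul, Category.comp_id]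

lemma smul_id_comp (a : R) {X Y : ModuleCat.{0} R} (φ : X ⟶ Y) : (a • 𝟙 X) ≫ φ = a • φ := by
  rw [Linear.smul_comp, Category.id_comp]

lemma ext_map_smul (a : R) (n : ℕ) (X Y : ModuleCat.{0} R) :
    ((Ext R (ModuleCat.{0} R) n).obj (Opposite.op X)).map (a • 𝟙 Y) = a • 𝟙 _ := by
  apply Quiver.Hom.op_inj
  change (NatTrans.leftDerived (homIntoMap (a • 𝟙 Y)) n).app X = (opScalar a).app _
  let P := projectiveResolution X
  rw [leftDerived_app_eq _ P, homologyMap_eq_of_central (opScalar a)]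
  · have := (opScalar a).naturality (leftDerivedIso (homInto Y) P n).inv
    erw [← this]
    exact (leftDerivedIso (homInto Y) P n).hom_inv_id_assoc _
  · intro i
    apply Quiver.Hom.unop_inj
    ext φ
    exact comp_smul_id a φ

lemma lc_map_smul (J : Ideal R) (j : ℕ) (a : R) (M : ModuleCat.{0} R) :
    (localCohomology J j).map (a • 𝟙 M) = a • 𝟙 _ := by
  apply (lcIsColimit J j M).hom_ext
  intro t
  refine (lcι_naturality J j (a • 𝟙 M) t).trans ?_
  have h : (lcDiagramMap J j (a • 𝟙 M)).app t = a • 𝟙 _ := ext_map_smul a j _ M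
  rw [h, smul_id_comp]
  exact (comp_smul_id a (lcι J j M t)).symm

end LinearAction

section InjectiveVanishing

variable {R : Type} [CommRing R]

lemma isZero_ext_succ_of_injective (X I : ModuleCat.{0} R) [Injective I] (n : ℕ) :
    IsZero (extObj (n + 1) X I) := by
  let P := projectiveResolution X
  refine IsZero.of_iso ?_ (P.isoExt (n + 1) I)
  rw [← HomologicalComplex.exactAt_iff_isZero_homology,
    HomologicalComplex.exactAt_iff' _ n (n + 1) (n + 2) (by simp) (by simp),
    ShortComplex.moduleCat_exact_iff]
  intro (φ : P.complex.X (n + 1) ⟶ I) (hφ : P.complex.d (n + 2) (n + 1) ≫ φ = 0)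
  have hex : (P.complex.sc' (n + 2) (n + 1) n).Exact :=
    (HomologicalComplex.exactAt_iff' _ _ _ _ (by simp) (by simp)).1 (P.complex_exactAt_succ n)
  exact ⟨hex.descToInjective φ hφ, hex.comp_descToInjective φ hφ⟩

lemma isZero_lc_succ_of_injective (J : Ideal R) (I : ModuleCat.{0} R) [Injective I] (n : ℕ) :
    IsZero (lcObj J (n + 1) I) := by
  rw [IsZero.iff_id_eq_zero]
  apply (lcIsColimit J (n + 1) I).hom_ext
  intro t
  exact (isZero_ext_succ_of_injective _ I n).eq_of_src _ _

end InjectiveVanishing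

section ExtZero

variable {R : Type} [CommRing R]

instance preservesFiniteLimits_linearYoneda_obj (Y : ModuleCat.{0} R) :
    PreservesFiniteLimits ((linearYoneda R (ModuleCat.{0} R)).obj Y) := by
  constructor
  intro K _ _
  have : PreservesLimitsOfShape K
      ((linearYoneda R (ModuleCat.{0} R)).obj Y ⋙ forget (ModuleCat.{0} R)) :=
    inferInstanceAs (PreservesLimitsOfShape K (yoneda.obj Y))
  exact preservesLimitsOfShape_of_reflects_of_preserves _ (forget (ModuleCat.{0} R))

instance preservesFiniteColimits_homInto (Y : ModuleCat.{0} R) :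
    PreservesFiniteColimits (homInto Y) :=
  preservesFiniteColimits_rightOp _

/-- The comparison map from `Hom` to `Ext` in degree zero. -/
noncomputable def homToExtZero (X Y : ModuleCat.{0} R) :
    ((linearYoneda R (ModuleCat.{0} R)).obj Y).obj (Opposite.op X) ⟶ extObj 0 X Y :=
  ((homInto Y).fromLeftDerivedZero.app X).unop

instance isIso_homToExtZero (X Y : ModuleCat.{0} R) : IsIso (homToExtZero X Y) := by
  have h : IsIso ((homInto Y).fromLeftDerivedZero.app X) := inferInstance
  exact isIso_unop ((homInto Y).fromLeftDerivedZero.app X)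

lemma homToExtZero_naturality_left {X X' : ModuleCat.{0} R} (f : X' ⟶ X) (Y : ModuleCat.{0} R) :
    homToExtZero X Y ≫ ((Ext R (ModuleCat.{0} R) 0).map f.op).app Y =
      ((linearYoneda R (ModuleCat.{0} R)).obj Y).map f.op ≫ homToExtZero X' Y :=
  Quiver.Hom.op_inj ((homInto Y).fromLeftDerivedZero.naturality f)

lemma homToExtZero_naturality_right (X : ModuleCat.{0} R) {Y Y' : ModuleCat.{0} R} (g : Y ⟶ Y') :
    homToExtZero X Y ≫ ((Ext R (ModuleCat.{0} R) 0).obj (Opposite.op X)).map g =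
      ((linearYoneda R (ModuleCat.{0} R)).map g).app (Opposite.op X) ≫ homToExtZero X Y' :=
  Quiver.Hom.op_inj (leftDerived_comp_fromLeftDerivedZero (homIntoMap g) X)

/-- Evaluation of a linear map at an element. -/
noncomputable def homEval {X : ModuleCat.{0} R} (x : X) (Y : ModuleCat.{0} R) :
    ((linearYoneda R (ModuleCat.{0} R)).obj Y).obj (Opposite.op X) ⟶ Y :=
  ModuleCat.ofHom
    { toFun := fun φ : X ⟶ Y => φ x
      map_add' := fun _ _ => rfl
      map_smul' := fun _ _ => rfl }

/-- Evaluation of an element of `Ext` in degree zero. -/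
noncomputable def extZeroEval {X : ModuleCat.{0} R} (x : X) (Y : ModuleCat.{0} R) :
    extObj 0 X Y ⟶ Y :=
  inv (homToExtZero X Y) ≫ homEval x Y

lemma extZeroEval_naturality_left {X X' : ModuleCat.{0} R} (f : X' ⟶ X) (x' : X')
    (Y : ModuleCat.{0} R) :
    ((Ext R (ModuleCat.{0} R) 0).map f.op).app Y ≫ extZeroEval x' Y = extZeroEval (f x') Y := by
  rw [← cancel_epi (homToExtZero X Y), extZeroEval, extZeroEval, IsIso.hom_inv_id_assoc,
    ← Category.assoc, homToExtZero_naturality_left, Category.assoc, IsIso.hom_inv_id_assoc]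
  rfl

lemma extZeroEval_naturality_right {X : ModuleCat.{0} R} (x : X) {Y Y' : ModuleCat.{0} R}
    (g : Y ⟶ Y') :
    ((Ext R (ModuleCat.{0} R) 0).obj (Opposite.op X)).map g ≫ extZeroEval x Y' =
      extZeroEval x Y ≫ g := by
  rw [← cancel_epi (homToExtZero X Y), extZeroEval, extZeroEval, ← Category.assoc,
    homToExtZero_naturality_right, Category.assoc, IsIso.hom_inv_id_assoc, Category.assoc,
    IsIso.hom_inv_id_assoc]
  rfl

lemma exists_extZeroEval_eq {X : ModuleCat.{0} R} (x : X) {Y : ModuleCat.{0} R} (φ : X ⟶ Y) :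
    ∃ z, extZeroEval x Y z = φ x := by
  refine ⟨homToExtZero X Y φ, ?_⟩
  have : homToExtZero X Y ≫ extZeroEval x Y = homEval x Y := IsIso.hom_inv_id_assoc _ _
  exact congr_arg (fun f => f.hom φ) this

lemma exists_hom_extZeroEval {X : ModuleCat.{0} R} (x : X) {Y : ModuleCat.{0} R}
    (z : extObj 0 X Y) : ∃ φ : X ⟶ Y, homToExtZero X Y φ = z ∧ extZeroEval x Y z = φ x := by
  obtain ⟨φ, rfl⟩ := ((ModuleCat.epi_iff_surjective (homToExtZero X Y)).1 inferInstance) z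
  refine ⟨φ, rfl, ?_⟩
  have : homToExtZero X Y ≫ extZeroEval x Y = homEval x Y := IsIso.hom_inv_id_assoc _ _
  exact congr_arg (fun f => f.hom φ) this

end ExtZero

section LocalCohomologyZero

variable {R : Type} [CommRing R] (J : Ideal R)

/-- The cocone defining the map from local cohomology in degree zero. -/
noncomputable def lcZeroCocone (M : ModuleCat.{0} R) : Cocone (lcDiagramAt J 0 M) where
  pt := M
  ι :=
    { app := fun t => extZeroEval
        (X := ModuleCat.of R (R ⧸ (localCohomology.idealPowersDiagram J).obj t.unop))
        (Ideal.Quotient.mk _ 1) M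
      naturality := fun _ _ a =>
        (extZeroEval_naturality_left
          ((localCohomology.ringModIdeals (localCohomology.idealPowersDiagram J)).map a.unop)
          _ M).trans (Category.comp_id _).symm }

/-- The inclusion of local cohomology in degree zero. -/
noncomputable def lcZeroMap (M : ModuleCat.{0} R) : lcObj J 0 M ⟶ M :=
  (lcIsColimit J 0 M).desc (lcZeroCocone J M)

lemma lcι_lcZeroMap (M : ModuleCat.{0} R) (t : (ℕᵒᵖ)ᵒᵖ) :
    lcι J 0 M t ≫ lcZeroMap J M = (lcZeroCocone J M).ι.app t :=
  (lcIsColimit J 0 M).fac _ t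

lemma lcZeroMap_naturality {M N : ModuleCat.{0} R} (g : M ⟶ N) :
    (localCohomology J 0).map g ≫ lcZeroMap J N = lcZeroMap J M ≫ g := by
  apply (lcIsColimit J 0 M).hom_ext
  intro t
  change lcι J 0 M t ≫ _ = lcι J 0 M t ≫ _
  rw [← Category.assoc, lcι_naturality, Category.assoc, lcι_lcZeroMap, ← Category.assoc,
    lcι_lcZeroMap]
  exact extZeroEval_naturality_right _ g

lemma lcZeroMap_injective (M : ModuleCat.{0} R) : Function.Injective (lcZeroMap J M) := by
  rw [injective_iff_map_eq_zero]
  intro y hy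
  obtain ⟨t, y, rfl⟩ := Concrete.isColimit_exists_rep _ (lcIsColimit J 0 M) y
  have h1 : lcZeroMap J M (lcι J 0 M t y) = (lcZeroCocone J M).ι.app t y :=
    congr_arg (fun f => f.hom y) (lcι_lcZeroMap J M t)
  have h2 : (lcZeroCocone J M).ι.app t y = 0 := h1.symm.trans hy
  obtain ⟨φ, hφ, h3⟩ := exists_hom_extZeroEval
    (X := ModuleCat.of R (R ⧸ (localCohomology.idealPowersDiagram J).obj t.unop))
        (Ideal.Quotient.mk _ 1) y
  have h4 : φ (Ideal.Quotient.mk _ 1) = 0 := h3.symm.trans h2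
  have h5 : φ = 0 := by
    refine ModuleCat.hom_ext (LinearMap.ext fun z => ?_)
    obtain ⟨r, rfl⟩ := Ideal.Quotient.mk_surjective z
    have : (Ideal.Quotient.mk ((localCohomology.idealPowersDiagram J).obj t.unop) r) =
      r • (Ideal.Quotient.mk ((localCohomology.idealPowersDiagram J).obj t.unop) 1) := by
      rw [Algebra.smul_def, map_one, mul_one]; rfl
    rw [this]
    exact (φ.hom.map_smul r _).trans ((congr_arg (fun z => r • z) h4).trans (smul_zero r))
  have h6 : y = 0 := by rw [← hφ, h5]; exact (homToExtZero _ _).hom.map_zero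
  rw [h6]
  exact map_zero _

lemma mem_range_lcZeroMap (M : ModuleCat.{0} R) (x : M) :
    (∃ y, lcZeroMap J M y = x) ↔ ∃ n, ∀ a ∈ J ^ n, a • x = 0 := by
  constructor
  · rintro ⟨y, rfl⟩
    obtain ⟨t, y, rfl⟩ := Concrete.isColimit_exists_rep _ (lcIsColimit J 0 M) y
    have h1 : lcZeroMap J M (lcι J 0 M t y) = (lcZeroCocone J M).ι.app t y :=
      congr_arg (fun f => f.hom y) (lcι_lcZeroMap J M t)
    obtain ⟨φ, hφ, h3⟩ := exists_hom_extZeroEval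
      (X := ModuleCat.of R (R ⧸ (localCohomology.idealPowersDiagram J).obj t.unop))
        (Ideal.Quotient.mk _ 1) y
    refine ⟨t.unop.unop, fun a ha => ?_⟩
    have h4 : lcZeroMap J M (lcι J 0 M t y) = φ (Ideal.Quotient.mk _ 1) := h1.trans h3
    refine (congr_arg (a • ·) h4).trans ((φ.hom.map_smul a _).symm.trans ?_)
    have h5 : a • (Ideal.Quotient.mk ((localCohomology.idealPowersDiagram J).obj t.unop) 1) = 0 := by
      rw [Algebra.smul_def, map_one, mul_one]
      exact Ideal.Quotient.eq_zero_iff_mem.2 ha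
    exact (congr_arg φ.hom h5).trans (map_zero φ.hom)
  · rintro ⟨n, hn⟩
    let t : (ℕᵒᵖ)ᵒᵖ := Opposite.op (Opposite.op n)
    let φ : ModuleCat.of R (R ⧸ J ^ n) ⟶ M :=
      ModuleCat.ofHom (Submodule.liftQ (J ^ n) (LinearMap.toSpanSingleton R M x) hn)
    obtain ⟨z, hz⟩ := exists_extZeroEval_eq
      (X := ModuleCat.of R (R ⧸ J ^ n)) (Ideal.Quotient.mk _ 1) φ
    refine ⟨lcι J 0 M t z, ?_⟩
    have h1 : lcZeroMap J M (lcι J 0 M t z) = (lcZeroCocone J M).ι.app t z :=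
      congr_arg (fun f => f.hom z) (lcι_lcZeroMap J M t)
    refine h1.trans (hz.trans ?_)
    change (LinearMap.toSpanSingleton R M x) 1 = x
    simp

end LocalCohomologyZero

section LocalCohomologyModules

variable {R : Type} [CommRing R] (J : Ideal R)

/-- Local cohomology of an unbundled module. -/
noncomputable abbrev LCoh (j : ℕ) (M : Type) [AddCommGroup M] [Module R M] : ModuleCat.{0} R :=
  (localCohomology J j).obj (ModuleCat.of R M)

variable {M N P : Type} [AddCommGroup M] [Module R M] [AddCommGroup N] [Module R N]
  [AddCommGroup P] [Module R P]

/-- The map induced on local cohomology. -/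
noncomputable def lcohMap (j : ℕ) (f : M →ₗ[R] N) : LCoh J j M →ₗ[R] LCoh J j N :=
  ((localCohomology J j).map (ModuleCat.ofHom f)).hom

lemma lcohMap_id (j : ℕ) : lcohMap J j (LinearMap.id : M →ₗ[R] M) = LinearMap.id := by
  have : (localCohomology J j).map (ModuleCat.ofHom (LinearMap.id : M →ₗ[R] M)) = 𝟙 _ :=
    (localCohomology J j).map_id _
  rw [lcohMap, this]
  rfl

lemma lcohMap_comp (j : ℕ) (g : N →ₗ[R] P) (f : M →ₗ[R] N) :
    lcohMap J j (g ∘ₗ f) = lcohMap J j g ∘ₗ lcohMap J j f := by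
  have : (localCohomology J j).map (ModuleCat.ofHom (g ∘ₗ f)) =
      (localCohomology J j).map (ModuleCat.ofHom f) ≫ (localCohomology J j).map (ModuleCat.ofHom g) :=
    (localCohomology J j).map_comp (ModuleCat.ofHom f) (ModuleCat.ofHom g)
  rw [lcohMap, this]
  rfl

lemma lcohMap_smul_id (j : ℕ) (a : R) :
    lcohMap J j (a • (LinearMap.id : M →ₗ[R] M)) = a • LinearMap.id :=
  congr_arg (fun f => f.hom) (lc_map_smul J j a (ModuleCat.of R M))

/-- Local cohomology of isomorphic modules. -/
noncomputable def lcohEquiv (j : ℕ) (e : M ≃ₗ[R] N) : LCoh J j M ≃ₗ[R] LCoh J j N :=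
  LinearEquiv.ofLinearMap (lcohMap J j e.toLinearMap) (lcohMap J j e.symm.toLinearMap)
    (by rw [← lcohMap_comp, LinearEquiv.comp_symm, lcohMap_id])
    (by rw [← lcohMap_comp, LinearEquiv.symm_comp, lcohMap_id])

lemma lcoh_long_exact {f : M →ₗ[R] N} {g : N →ₗ[R] P} (hf : Function.Injective f)
    (hfg : Function.Exact f g) (hg : Function.Surjective g) (j : ℕ) :
    Function.Exact (lcohMap J j f) (lcohMap J j g) ∧
      ∃ δ : LCoh J j P →ₗ[R] LCoh J (j + 1) M, Function.Exact (lcohMap J j g) δ ∧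
        Function.Exact δ (lcohMap J (j + 1) f) := by
  have w : ModuleCat.ofHom f ≫ ModuleCat.ofHom g = 0 := by
    ext x
    exact hfg.apply_apply_eq_zero x
  have hS : (ShortComplex.mk (ModuleCat.ofHom f) (ModuleCat.ofHom g) w).ShortExact :=
    { exact := (ShortComplex.ShortExact.moduleCat_exact_iff_function_exact _).2 hfg
      mono_f := (ModuleCat.mono_iff_injective _).2 hf
      epi_g := (ModuleCat.epi_iff_surjective _).2 hg }
  exact ⟨lc_exact₂ J hS j, (lcδ J hS j).hom, lc_exact₃ J hS j, lc_exact₁ J hS j⟩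

lemma subsingleton_lcoh_of_injective [hI : Module.Injective R M] (j : ℕ) :
    Subsingleton (LCoh J (j + 1) M) := by
  have : Injective (ModuleCat.of R M) := Module.injective_object_of_injective_module R M
  exact ModuleCat.subsingleton_of_isZero (isZero_lc_succ_of_injective J (ModuleCat.of R M) j)

/-- The inclusion of the zeroth local cohomology. -/
noncomputable def lcohZero (M : Type) [AddCommGroup M] [Module R M] : LCoh J 0 M →ₗ[R] M :=
  (lcZeroMap J (ModuleCat.of R M)).hom

lemma lcohZero_injective : Function.Injective (lcohZero J M) :=
  lcZeroMap_injective J (ModuleCat.of R M)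

lemma lcohZero_lcohMap (f : M →ₗ[R] N) (y : LCoh J 0 M) :
    lcohZero J N (lcohMap J 0 f y) = f (lcohZero J M y) :=
  congr_arg (fun φ => φ.hom y) (lcZeroMap_naturality J (ModuleCat.ofHom f))

/-- The submodule of elements killed by a power of an ideal. -/
def gammaSub (M : Type) [AddCommGroup M] [Module R M] : Submodule R M where
  carrier := {x | ∃ n, ∀ a ∈ J ^ n, a • x = 0}
  zero_mem' := ⟨0, fun a _ => smul_zero a⟩
  add_mem' := by
    rintro x y ⟨n, hn⟩ ⟨k, hk⟩
    refine ⟨max n k, fun a ha => ?_⟩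
    rw [smul_add, hn a (Ideal.pow_le_pow_right (le_max_left n k) ha),
      hk a (Ideal.pow_le_pow_right (le_max_right n k) ha), add_zero]
  smul_mem' := by
    rintro r x ⟨n, hn⟩
    exact ⟨n, fun a ha => by rw [smul_comm, hn a ha, smul_zero]⟩

lemma mem_gammaSub {x : M} : x ∈ gammaSub J M ↔ ∃ n, ∀ a ∈ J ^ n, a • x = 0 := Iff.rfl

lemma range_lcohZero : LinearMap.range (lcohZero J M) = gammaSub J M := by
  ext x
  exact mem_range_lcZeroMap J (ModuleCat.of R M) x

/-- The zeroth local cohomology is the torsion submodule. -/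
noncomputable def lcohZeroEquiv (M : Type) [AddCommGroup M] [Module R M] :
    LCoh J 0 M ≃ₗ[R] gammaSub J M :=
  (LinearEquiv.ofInjective _ (lcohZero_injective J)).trans
    (LinearEquiv.ofEq _ _ (range_lcohZero J))

lemma gammaSub_map_mem (f : M →ₗ[R] N) {x : M} (hx : x ∈ gammaSub J M) : f x ∈ gammaSub J N := by
  obtain ⟨n, hn⟩ := hx
  exact ⟨n, fun a ha => by rw [← map_smul, hn a ha, map_zero]⟩

lemma gammaSub_eq_top_of_injective {f : M →ₗ[R] N} (hf : Function.Injective f)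
    (h : gammaSub J N = ⊤) : gammaSub J M = ⊤ := by
  rw [eq_top_iff]
  intro x _
  obtain ⟨n, hn⟩ : f x ∈ gammaSub J N := h ▸ Submodule.mem_top
  exact ⟨n, fun a ha => hf (by rw [map_smul, hn a ha, map_zero])⟩

lemma gammaSub_eq_top_of_surjective {f : M →ₗ[R] N} (hf : Function.Surjective f)
    (h : gammaSub J M = ⊤) : gammaSub J N = ⊤ := by
  rw [eq_top_iff]
  intro y _
  obtain ⟨x, rfl⟩ := hf y
  exact gammaSub_map_mem J f (h ▸ Submodule.mem_top)

lemma gammaSub_gammaSub : gammaSub J (gammaSub J M) = ⊤ := by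
  rw [eq_top_iff]
  rintro ⟨x, n, hn⟩ _
  exact ⟨n, fun a ha => Subtype.ext (hn a ha)⟩

lemma exists_pow_smul_eq_zero_of_fg [Module.Finite R M] (h : gammaSub J M = ⊤) :
    ∃ n, ∀ a ∈ J ^ n, ∀ x : M, a • x = 0 := by
  obtain ⟨s, hs⟩ := (Module.Finite.fg_top : (⊤ : Submodule R M).FG)
  have h' : ∀ x : M, ∃ n, ∀ a ∈ J ^ n, a • x = 0 := fun x =>
    (mem_gammaSub J).1 (h ▸ Submodule.mem_top)
  choose n hn using h'
  refine ⟨s.sup n, fun a ha x => ?_⟩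
  have hx : x ∈ Submodule.span R (s : Set M) := hs ▸ Submodule.mem_top
  induction hx using Submodule.span_induction with
  | mem x hx => exact hn x a (Ideal.pow_le_pow_right (Finset.le_sup hx) ha)
  | zero => exact smul_zero a
  | add x y _ _ hx hy => rw [smul_add, hx, hy, add_zero]
  | smul r x _ hx => rw [smul_comm, hx, smul_zero]

lemma injective_gammaSub [IsNoetherianRing R] (I : Type) [AddCommGroup I] [Module R I]
    [hI : Module.Injective R I] : Module.Injective R (gammaSub J I) := by
  apply Module.Baer.injective
  intro 𝔞 g
  obtain ⟨n, hn⟩ : ∃ n, ∀ a ∈ J ^ n, ∀ x : LinearMap.range g, a • x = 0 :=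
    exists_pow_smul_eq_zero_of_fg J
      (gammaSub_eq_top_of_injective J (Submodule.injective_subtype _) (gammaSub_gammaSub J))
  obtain ⟨k, hk⟩ := Ideal.exists_pow_inf_eq_pow_smul J (𝔞 : Submodule R R)
  have hker : ∀ x : 𝔞, (x : R) ∈ J ^ (n + k) → g x = 0 := by
    have key : ∀ y ∈ J ^ n • (J ^ k • (⊤ : Submodule R R) ⊓ 𝔞), ∀ hy : y ∈ 𝔞, g ⟨y, hy⟩ = 0 := by
      intro y hy
      induction hy using Submodule.smul_induction_on' with
      | smul r hr z hz =>
        intro hy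
        have : (⟨r • z, hy⟩ : 𝔞) = r • ⟨z, hz.2⟩ := rfl
        rw [this, map_smul]
        exact congr_arg Subtype.val (hn r hr ⟨g ⟨z, hz.2⟩, LinearMap.mem_range_self g _⟩)
      | add y hy z hz hy' hz' =>
        intro hyz
        have h1 : y ∈ 𝔞 := (Submodule.smul_le_right.trans inf_le_right) hy
        have h2 : z ∈ 𝔞 := (Submodule.smul_le_right.trans inf_le_right) hz
        have : (⟨y + z, hyz⟩ : 𝔞) = ⟨y, h1⟩ + ⟨z, h2⟩ := rfl
        rw [this, map_add, hy' h1, hz' h2, add_zero]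
    intro x hx
    refine key x ?_ x.2
    have := hk (n + k) (Nat.le_add_left k n)
    rw [Nat.add_sub_cancel] at this
    rw [← this]
    exact ⟨by simpa using hx, x.2⟩
  let i : (𝔞 ⧸ LinearMap.ker ((Submodule.mkQ (J ^ (n + k))) ∘ₗ Submodule.subtype 𝔞)) →ₗ[R]
      R ⧸ J ^ (n + k) := Submodule.liftQ _ ((Submodule.mkQ (J ^ (n + k))) ∘ₗ Submodule.subtype 𝔞) le_rfl
  have hi : Function.Injective i := by
    rw [← LinearMap.ker_eq_bot]
    exact Submodule.ker_liftQ_eq_bot _ _ _ le_rfl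
  have hgk : LinearMap.ker ((Submodule.mkQ (J ^ (n + k))) ∘ₗ Submodule.subtype 𝔞) ≤
      LinearMap.ker g := by
    intro x hx
    exact hker x ((Submodule.Quotient.mk_eq_zero _).1 hx)
  obtain ⟨h, hh⟩ := hI.out i hi ((Submodule.subtype _) ∘ₗ Submodule.liftQ _ g hgk)
  refine ⟨LinearMap.codRestrict (gammaSub J I) (h ∘ₗ Submodule.mkQ _) fun r => ⟨n + k, fun a ha => ?_⟩,
    fun x hx => ?_⟩
  · rw [← map_smul]
    have : a • r ∈ J ^ (n + k) := Ideal.mul_mem_right _ _ ha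
    rw [LinearMap.comp_apply, Submodule.mkQ_apply, (Submodule.Quotient.mk_eq_zero _).2 this, map_zero]
  · apply Subtype.ext
    exact hh (Submodule.Quotient.mk ⟨x, hx⟩)

lemma exists_injective_embedding (M : Type) [AddCommGroup M] [Module R M] :
    ∃ (I : ModuleCat.{0} R) (f : M →ₗ[R] I), Module.Injective R I ∧ Function.Injective f := by
  have h : Injective (Injective.under (ModuleCat.of R M)) := inferInstance
  exact ⟨Injective.under (ModuleCat.of R M), (Injective.ι (ModuleCat.of R M)).hom,
    @Module.injective_module_of_injective_object R _ _ _ _ h,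
    (ModuleCat.mono_iff_injective (Injective.ι (ModuleCat.of R M))).1 inferInstance⟩

lemma subsingleton_lcoh_of_torsion [IsNoetherianRing R] (j : ℕ) :
    ∀ (C : Type) [AddCommGroup C] [Module R C], gammaSub J C = ⊤ →
      Subsingleton (LCoh J (j + 1) C) := by
  induction j with
  | zero =>
    intro C _ _ hC
    obtain ⟨I, f, hI, hf⟩ := exists_injective_embedding (R := R) C
    have hG := injective_gammaSub J I
    let f' : C →ₗ[R] gammaSub J I :=
      LinearMap.codRestrict _ f fun x => gammaSub_map_mem J f (hC ▸ Submodule.mem_top)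
    have hf' : Function.Injective f' := fun x y h => hf (congr_arg Subtype.val h)
    let g := Submodule.mkQ (LinearMap.range f')
    obtain ⟨-, δ, h1, h2⟩ := lcoh_long_exact J hf' (LinearMap.exact_map_mkQ_range f')
      (Submodule.mkQ_surjective _) 0
    have := subsingleton_lcoh_of_injective J (M := gammaSub J I) 0
    refine subsingleton_of_forall_eq 0 fun y => ?_
    obtain ⟨z, rfl⟩ := (h2 y).1 (Subsingleton.elim _ _)
    refine (h1 z).2 ?_
    obtain ⟨w, hw⟩ := Submodule.mkQ_surjective _ (lcohZero J _ z)
    have hw' : w ∈ LinearMap.range (lcohZero J (gammaSub J I)) := by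
      rw [range_lcohZero, gammaSub_gammaSub]; trivial
    obtain ⟨u, rfl⟩ := hw'
    refine ⟨u, lcohZero_injective J ?_⟩
    rw [lcohZero_lcohMap, hw]
  | succ j ih =>
    intro C _ _ hC
    obtain ⟨I, f, hI, hf⟩ := exists_injective_embedding (R := R) C
    have hG := injective_gammaSub J I
    let f' : C →ₗ[R] gammaSub J I :=
      LinearMap.codRestrict _ f fun x => gammaSub_map_mem J f (hC ▸ Submodule.mem_top)
    have hf' : Function.Injective f' := fun x y h => hf (congr_arg Subtype.val h)
    obtain ⟨-, δ, h1, h2⟩ := lcoh_long_exact J hf' (LinearMap.exact_map_mkQ_range f')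
      (Submodule.mkQ_surjective _) (j + 1)
    have := subsingleton_lcoh_of_injective J (M := gammaSub J I) (j + 1)
    have := ih (gammaSub J I ⧸ LinearMap.range f')
      (gammaSub_eq_top_of_surjective J (Submodule.mkQ_surjective _) (gammaSub_gammaSub J))
    refine subsingleton_of_forall_eq 0 fun y => ?_
    obtain ⟨z, rfl⟩ := (h2 y).1 (Subsingleton.elim _ _)
    rw [Subsingleton.elim z 0, map_zero]

lemma gammaSub_lcoh_eq_top (j : ℕ) : ∀ (M : Type) [AddCommGroup M] [Module R M],
    gammaSub J (LCoh J j M) = ⊤ := by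
  induction j with
  | zero =>
    intro M _ _
    exact gammaSub_eq_top_of_injective J (lcohZeroEquiv J M).injective (gammaSub_gammaSub J)
  | succ j ih =>
    intro M _ _
    obtain ⟨I, f, hI, hf⟩ := exists_injective_embedding (R := R) M
    obtain ⟨-, δ, h1, h2⟩ := lcoh_long_exact J hf (LinearMap.exact_map_mkQ_range f)
      (Submodule.mkQ_surjective _) j
    have := subsingleton_lcoh_of_injective J (M := I) j
    refine gammaSub_eq_top_of_surjective J (f := δ) (fun y => ?_) (ih _)
    exact (h2 y).1 (Subsingleton.elim _ _)

end LocalCohomologyModules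

end HomologicalAlgebra

section Duality

variable {R : Type} [CommRing R] {E : Type} [AddCommGroup E] [Module R E]
  {A B C : Type} [AddCommGroup A] [Module R A] [AddCommGroup B] [Module R B]
  [AddCommGroup C] [Module R C]

lemma exact_lcomp_of_injective [hE : Module.Injective R E] {f : A →ₗ[R] B} {g : B →ₗ[R] C}
    (h : Function.Exact f g) : Function.Exact (LinearMap.lcomp R E g) (LinearMap.lcomp R E f) := by
  intro φ
  constructor
  · intro hφ
    have hker : LinearMap.ker g ≤ LinearMap.ker φ := by
      intro x hx
      obtain ⟨y, rfl⟩ := (h x).1 hx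
      exact LinearMap.congr_fun hφ y
    have hi : Function.Injective (Submodule.liftQ (LinearMap.ker g) g le_rfl) := by
      rw [← LinearMap.ker_eq_bot]
      exact Submodule.ker_liftQ_eq_bot _ _ _ le_rfl
    obtain ⟨ψ, hψ⟩ := hE.out _ hi (Submodule.liftQ _ φ hker)
    exact ⟨ψ, LinearMap.ext fun x => hψ (Submodule.Quotient.mk x)⟩
  · rintro ⟨ψ, rfl⟩
    ext x
    simp [h.apply_apply_eq_zero]

lemma lcomp_injective_of_surjective {g : B →ₗ[R] C} (hg : Function.Surjective g) :
    Function.Injective (LinearMap.lcomp R E g) := fun _ _ h =>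
  LinearMap.cancel_right hg |>.1 h

lemma lcomp_surjective_of_injective [hE : Module.Injective R E] {f : A →ₗ[R] B}
    (hf : Function.Injective f) : Function.Surjective (LinearMap.lcomp R E f) := fun φ => by
  obtain ⟨ψ, hψ⟩ := hE.out f hf φ
  exact ⟨ψ, LinearMap.ext hψ⟩

variable [IsLocalRing R]

lemma length_residue_dual (hE : IsInjEnvResidue R E) :
    Module.length R ((R ⧸ maximalIdeal R) →ₗ[R] E) = 1 := by
  obtain ⟨-, ι, hι, hess⟩ := hE
  let F : (R ⧸ maximalIdeal R) →ₗ[R] ((R ⧸ maximalIdeal R) →ₗ[R] E) :=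
    (LinearMap.llcomp R _ _ _ ι) ∘ₗ (LinearMap.mul R (R ⧸ maximalIdeal R))
  have hF : ∀ z w, F z w = ι (z * w) := fun _ _ => rfl
  have hinj : Function.Injective F := by
    intro z w h
    have := LinearMap.congr_fun h 1
    rw [hF, hF, mul_one, mul_one] at this
    exact hι this
  have key : ∀ φ : (R ⧸ maximalIdeal R) →ₗ[R] E, φ 1 ∈ LinearMap.range ι := by
    intro φ
    by_cases h0 : φ 1 = 0
    · rw [h0]; exact Submodule.zero_mem _
    · have h1 : Submodule.span R {φ 1} ⊓ LinearMap.range ι ≠ ⊥ := fun h =>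
        h0 (Submodule.span_singleton_eq_bot.1 (hess _ h))
      obtain ⟨y, ⟨hy1, hy2⟩, hy0⟩ := Submodule.exists_mem_ne_zero_of_ne_bot h1
      obtain ⟨r, rfl⟩ := Submodule.mem_span_singleton.1 hy1
      have hr : r ∉ maximalIdeal R := by
        intro hr
        apply hy0
        rw [← map_smul, Algebra.smul_def, mul_one]
        have : algebraMap R (R ⧸ maximalIdeal R) r = 0 := Ideal.Quotient.eq_zero_iff_mem.2 hr
        rw [this, map_zero]
      obtain ⟨u, rfl⟩ : IsUnit r := by simpa using hr
      have := Submodule.smul_mem _ ((u⁻¹ : Rˣ) : R) hy2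
      rwa [smul_smul, Units.inv_mul, one_smul] at this
  have hsurj : Function.Surjective F := by
    intro φ
    obtain ⟨z, hz⟩ := key φ
    refine ⟨z, LinearMap.ext fun w => ?_⟩
    obtain ⟨w, rfl⟩ := Ideal.Quotient.mk_surjective w
    have : Ideal.Quotient.mk (maximalIdeal R) w = w • (1 : R ⧸ maximalIdeal R) := by
      rw [Algebra.smul_def, mul_one]; rfl
    rw [hF, this, map_smul, mul_smul_comm, mul_one, map_smul, hz]
  rw [← (LinearEquiv.ofBijective F ⟨hinj, hsurj⟩).length_eq]
  have : IsSimpleModule R (R ⧸ maximalIdeal R) :=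
    isSimpleModule_iff_isCoatom.2 (Ideal.isMaximal_def.1 inferInstance)
  exact Module.length_eq_one R _

lemma length_dual (hE : IsInjEnvResidue R E) {X : Type} [AddCommGroup X] [Module R X]
    (hX : IsFiniteLength R X) : Module.length R (X →ₗ[R] E) = Module.length R X := by
  have := hE.1
  induction hX with
  | @of_subsingleton M _ _ _ =>
    rw [Module.length_eq_zero, Module.length_eq_zero]
  | @of_simple_quotient M _ _ N hs hN ih =>
    rw [Module.length_eq_add_of_exact (LinearMap.lcomp R E N.mkQ) (LinearMap.lcomp R E N.subtype)
      (lcomp_injective_of_surjective N.mkQ_surjective)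
      (lcomp_surjective_of_injective N.subtype_injective)
      (exact_lcomp_of_injective (LinearMap.exact_subtype_mkQ N)), ih,
      Module.length_eq_add_of_exact N.subtype N.mkQ N.subtype_injective N.mkQ_surjective
        (LinearMap.exact_subtype_mkQ N), add_comm]
    congr 1
    obtain ⟨I, hI, ⟨e⟩⟩ := isSimpleModule_iff_quot_maximal.1 hs
    rw [Module.length_eq_one R (M ⧸ N)]
    have hIm : I = maximalIdeal R := IsLocalRing.eq_maximalIdeal hI
    subst hIm
    rw [← length_residue_dual hE]
    exact (e.symm.congrLeft E R).symm.length_eq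

end Duality

section Growth

/-- The summation operator. -/
def partialSum (f : ℕ → ℕ) (n : ℕ) : ℕ := ∑ i ∈ Finset.range n, f i

lemma partialSum_mono {f g : ℕ → ℕ} (h : ∀ n, f n ≤ g n) (k n : ℕ) :
    partialSum^[k] f n ≤ partialSum^[k] g n := by
  induction k generalizing f g with
  | zero => exact h n
  | succ k ih =>
    rw [Function.iterate_succ_apply, Function.iterate_succ_apply]
    exact ih fun n => Finset.sum_le_sum fun i _ => h i

lemma partialSum_add (f g : ℕ → ℕ) (k n : ℕ) :
    partialSum^[k] (fun n => f n + g n) n = partialSum^[k] f n + partialSum^[k] g n := by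
  induction k generalizing f g with
  | zero => rfl
  | succ k ih =>
    rw [Function.iterate_succ_apply, Function.iterate_succ_apply, Function.iterate_succ_apply,
      ← ih]
    exact congrArg (fun h => partialSum^[k] h n) (funext fun _ => Finset.sum_add_distrib)

lemma partialSum_mul (c : ℕ) (f : ℕ → ℕ) (k n : ℕ) :
    partialSum^[k] (fun n => c * f n) n = c * partialSum^[k] f n := by
  induction k generalizing f with
  | zero => rfl
  | succ k ih =>
    rw [Function.iterate_succ_apply, Function.iterate_succ_apply, ← ih]
    exact congrArg (fun h => partialSum^[k] h n) (funext fun _ => (Finset.mul_sum _ _ _).symm)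

lemma partialSum_pow_le (d k n : ℕ) :
    partialSum^[k] (fun n => (n + 1) ^ d) n ≤ (n + 1) ^ (d + k) := by
  induction k generalizing d with
  | zero => rfl
  | succ k ih =>
    rw [Function.iterate_succ_apply, ← add_assoc, add_right_comm]
    refine le_trans (partialSum_mono (fun n => ?_) k n) (ih (d + 1))
    calc partialSum (fun n => (n + 1) ^ d) n ≤ ∑ _i ∈ Finset.range n, (n + 1) ^ d :=
          Finset.sum_le_sum fun i hi => Nat.pow_le_pow_left
            (by have := Finset.mem_range.1 hi; omega) d
      _ = n * (n + 1) ^ d := by simp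
      _ ≤ (n + 1) ^ (d + 1) := by rw [pow_succ']; gcongr; omega

lemma partialSum_choose (d k n : ℕ) :
    partialSum^[k] (fun n => n.choose d) n = n.choose (d + k) := by
  induction k generalizing d with
  | zero => rfl
  | succ k ih =>
    rw [Function.iterate_succ_apply, ← add_assoc, add_right_comm, ← ih]
    refine congrArg (fun h => partialSum^[k] h n) (funext fun n => ?_)
    induction n with
    | zero => simp [partialSum]
    | succ n ihn =>
      rw [partialSum, Finset.sum_range_succ, Nat.choose_succ_succ', add_comm, ← ihn]
      rfl

lemma partialSum_shift_le {f g : ℕ → ℕ} {a : ℕ} (h : ∀ n, g n ≤ f (n + a)) (k n : ℕ) :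
    partialSum^[k] g n ≤ partialSum^[k] f (n + a) := by
  induction k generalizing f g with
  | zero => exact h n
  | succ k ih =>
    rw [Function.iterate_succ_apply, Function.iterate_succ_apply]
    refine ih fun n => ?_
    calc partialSum g n ≤ ∑ i ∈ Finset.range n, f (i + a) := Finset.sum_le_sum fun i _ => h i
      _ ≤ ∑ i ∈ Finset.range a, f i + ∑ i ∈ Finset.range n, f (a + i) := by
        simp only [add_comm a]; omega
      _ = partialSum f (n + a) := by rw [partialSum, add_comm n a, Finset.sum_range_add]

/-- `f` grows (after some number of summations) at most like a polynomial function of degree `r`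
with normalised leading coefficient `e`. -/
def GrowthLE (f : ℕ → ℕ) (r e : ℕ) : Prop :=
  ∃ k a c, ∀ n, partialSum^[k] f n ≤ e * (n + a).choose (r + k) + c * (n + 1) ^ (r + k - 1)

lemma GrowthLE.add_const {f g : ℕ → ℕ} {r e : ℕ} (hr : 1 ≤ r) (hf : GrowthLE f r e) (b : ℕ)
    (h : ∀ n, g n ≤ f n + b) : GrowthLE g r e := by
  obtain ⟨k, a, c, hc⟩ := hf
  refine ⟨k, a, c + b, fun n => ?_⟩
  have h1 : partialSum^[k] g n ≤ partialSum^[k] f n + b * (n + 1) ^ k := by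
    refine (partialSum_mono h k n).trans ?_
    rw [partialSum_add]
    have := partialSum_pow_le 0 k n
    have h2 := partialSum_mul b (fun n => (n + 1) ^ 0) k n
    simp only [pow_zero, mul_one, zero_add] at this h2
    rw [h2]
    gcongr
  have h2 : b * (n + 1) ^ k ≤ b * (n + 1) ^ (r + k - 1) :=
    Nat.mul_le_mul_left _ (Nat.pow_le_pow_right (by omega) (by omega))
  rw [add_mul]
  linarith [hc n]

lemma GrowthLE.shift {f g : ℕ → ℕ} {r e : ℕ} (hf : GrowthLE f r e) (b : ℕ)
    (h : ∀ n, g n ≤ f (n + b)) : GrowthLE g r e := by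
  obtain ⟨k, a, c, hc⟩ := hf
  refine ⟨k, b + a, c * (b + 1) ^ (r + k - 1), fun n => ?_⟩
  refine (partialSum_shift_le h k n).trans ((hc _).trans ?_)
  rw [add_assoc n b a, mul_assoc, ← mul_pow]
  gcongr
  nlinarith

lemma GrowthLE.of_partialSum {f g : ℕ → ℕ} {r e : ℕ} (hr : 1 ≤ r) (hf : GrowthLE f (r + 1) e)
    (b : ℕ) (h : ∀ n, partialSum g n ≤ f n + b * (n + 1)) : GrowthLE g r e := by
  obtain ⟨k, a, c, hc⟩ := hf
  refine ⟨k + 1, a, c + b, fun n => ?_⟩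
  rw [Function.iterate_succ_apply]
  refine (partialSum_mono h k n).trans ?_
  rw [partialSum_add, partialSum_mul]
  have h1 := partialSum_pow_le 1 k n
  simp only [pow_one] at h1
  have h2 : b * partialSum^[k] (fun n => n + 1) n ≤ b * (n + 1) ^ (r + (k + 1) - 1) :=
    Nat.mul_le_mul_left _ (h1.trans (Nat.pow_le_pow_right (by omega) (by omega)))
  have h3 := hc n
  rw [show r + 1 + k = r + (k + 1) by ring] at h3
  rw [add_mul]
  linarith

lemma choose_add_le (k a n : ℕ) :
    (n + a).choose (k + 1) ≤ n.choose (k + 1) + a * (a + 1) ^ k * (n + 1) ^ k := by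
  have key : ∀ b ≤ a, (n + b).choose (k + 1) ≤ n.choose (k + 1) + b * ((a + 1) ^ k * (n + 1) ^ k) := by
    intro b
    induction b with
    | zero => simp
    | succ b ih =>
      intro hb
      have h1 := ih (by omega)
      have h2 : (n + b).choose k ≤ (a + 1) ^ k * (n + 1) ^ k := by
        rw [← mul_pow]
        refine (Nat.choose_le_pow _ _).trans (Nat.pow_le_pow_left ?_ k)
        nlinarith
      rw [← add_assoc, Nat.choose_succ_succ', add_mul, one_mul]
      linarith
  simpa [mul_assoc] using key a le_rfl

lemma not_choose_le (k c : ℕ) : ¬ ∀ n : ℕ, n.choose (k + 1) ≤ c * (n + 1) ^ k := by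
  intro h
  set C := (k + 1).factorial * c * (k + 2) ^ k with hC
  have h1 := Nat.pow_le_choose (α := ℚ) (k + 1) (C + 1 + k)
  rw [div_le_iff₀' (by positivity)] at h1
  have h2 := h (C + 1 + k)
  have h3 : (C + 1 + k + 1) ^ k ≤ (k + 2) ^ k * (C + 1) ^ k := by
    rw [← mul_pow]
    exact Nat.pow_le_pow_left (by nlinarith) k
  have h4 : (C + 1) ^ (k + 1) ≤ C * (C + 1) ^ k := by
    calc (C + 1) ^ (k + 1) = (C + 1 + k + 1 - (k + 1)) ^ (k + 1) := by congr 1; omega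
      _ ≤ (k + 1).factorial * (C + 1 + k).choose (k + 1) := by
        exact_mod_cast h1
      _ ≤ (k + 1).factorial * (c * ((k + 2) ^ k * (C + 1) ^ k)) := by
        gcongr
        exact h2.trans (Nat.mul_le_mul_left _ h3)
      _ = C * (C + 1) ^ k := by rw [hC]; ring
  rw [pow_succ'] at h4
  have : 0 < (C + 1) ^ k := by positivity
  nlinarith

lemma GrowthLE.le_of_monotone {f g : ℕ → ℕ} {e : ℕ} (hf : GrowthLE f 1 e) (hg : Monotone g)
    (t b : ℕ) (h : ∀ n, partialSum g n ≤ f n + t * n + b) (n₀ : ℕ) : g n₀ ≤ e + t := by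
  by_contra! hlt
  obtain ⟨k, a, c, hc⟩ := hf
  have h1 : ∀ n, (e + 1) * n ≤ f n + (b + g n₀ * n₀) := by
    intro n
    have h2 : g n₀ * n ≤ partialSum g n + g n₀ * n₀ := by
      rcases le_total n n₀ with hn | hn
      · exact (Nat.mul_le_mul_left _ hn).trans (Nat.le_add_left _ _)
      · obtain ⟨m, rfl⟩ := Nat.exists_eq_add_of_le hn
        rw [partialSum, Finset.sum_range_add, mul_add]
        have : ∑ _i ∈ Finset.range m, g n₀ ≤ ∑ i ∈ Finset.range m, g (n₀ + i) :=
          Finset.sum_le_sum fun i _ => hg (Nat.le_add_right _ _)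
        rw [Finset.sum_const, Finset.card_range, smul_eq_mul, mul_comm] at this
        omega
    have h3 : (e + 1 + t) * n ≤ g n₀ * n := Nat.mul_le_mul_right _ (by omega)
    have := h n
    rw [add_mul _ t] at h3
    omega
  set B := b + g n₀ * n₀
  apply not_choose_le k (e * (a * (a + 1) ^ k) + c + B)
  intro n
  have h2 := partialSum_mono h1 k n
  rw [partialSum_mul, partialSum_add] at h2
  have h3 := partialSum_choose 1 k n
  simp only [Nat.choose_one_right] at h3
  have h4 := partialSum_pow_le 0 k n
  have h5 := partialSum_mul B (fun n => (n + 1) ^ 0) k n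
  simp only [pow_zero, mul_one, zero_add] at h4 h5
  rw [h3, h5] at h2
  have h6 := hc n
  rw [add_comm 1 k, Nat.add_sub_cancel] at h6
  rw [add_comm 1 k] at h2
  have h7 := Nat.mul_le_mul_left e (choose_add_le k a n)
  have h8 := Nat.mul_le_mul_left B h4
  nlinarith

end Growth

section Lengths

variable {R : Type} [CommRing R]

lemma length_le_of_exact {A B C : Type} [AddCommGroup A] [Module R A] [AddCommGroup B] [Module R B]
    [AddCommGroup C] [Module R C] {f : A →ₗ[R] B} {g : B →ₗ[R] C} (h : Function.Exact f g) :
    Module.length R B ≤ Module.length R A + Module.length R C := by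
  rw [Module.length_eq_add_of_exact (LinearMap.ker g).subtype g.rangeRestrict
    (Submodule.subtype_injective _) g.surjective_rangeRestrict
    (by rw [LinearMap.exact_iff, LinearMap.ker_rangeRestrict, Submodule.range_subtype])]
  refine add_le_add ?_ (Module.length_le_of_injective _ (Submodule.subtype_injective _))
  rw [h.linearMap_ker_eq]
  exact Module.length_le_of_surjective _ f.surjective_rangeRestrict

lemma mLength_eq_coe_iff {M : Type} [AddCommGroup M] [Module R M] (l : ℕ) :
    mLength R M = ((l : ℕ∞) : WithBot ℕ∞) ↔ Module.length R M = l := by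
  rw [mLength, ← Module.coe_length, WithBot.coe_inj]

variable [IsLocalRing R]

/-- `Q` is contained in the maximal ideal and contains one of its powers. -/
def MPrimary (Q : Ideal R) : Prop :=
  Q ≤ maximalIdeal R ∧ ∃ k, maximalIdeal R ^ k ≤ Q

variable [IsNoetherianRing R]

lemma isFiniteLength_of_pow_smul_eq_zero {W : Type} [AddCommGroup W] [Module R W]
    [Module.Finite R W] {k : ℕ} (h : ∀ a ∈ maximalIdeal R ^ k, ∀ x : W, a • x = 0) :
    IsFiniteLength R W := by
  rw [isFiniteLength_iff_isNoetherian_isArtinian]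
  refine ⟨inferInstance, ?_⟩
  rcases subsingleton_or_nontrivial W with hW | hW
  · infer_instance
  set I := maximalIdeal R ^ k
  have hI : I ≠ ⊤ := by
    intro hI
    obtain ⟨x, hx⟩ := exists_ne (0 : W)
    exact hx (by simpa using h 1 (hI ▸ Submodule.mem_top) x)
  have : Nontrivial (R ⧸ I) := Ideal.Quotient.nontrivial_iff.mpr hI
  have := IsLocalRing.of_surjective' (Ideal.Quotient.mk I) Ideal.Quotient.mk_surjective
  have := IsLocalHom.of_surjective (Ideal.Quotient.mk I) Ideal.Quotient.mk_surjective
  have hart : IsArtinianRing (R ⧸ I) := by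
    rw [isArtinianRing_iff_isNilpotent_maximalIdeal]
    refine ⟨k, ?_⟩
    rw [← map_maximalIdeal_of_surjective _ Ideal.Quotient.mk_surjective, ← Ideal.map_pow]
    exact Ideal.map_quotient_self I
  have ht : Module.IsTorsionBySet R W I := fun x a => h a a.2 x
  let _ := ht.module
  have : IsScalarTower R (R ⧸ I) W := ht.isScalarTower
  have : Module.Finite (R ⧸ I) W := Module.Finite.of_restrictScalars_finite R _ _
  exact isArtinian_of_surjective_algebraMap (S := R) (R := R ⧸ I) Ideal.Quotient.mk_surjective

omit [IsNoetherianRing R] in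
lemma gammaSub_eq_top_of_isFiniteLength {W : Type} [AddCommGroup W] [Module R W]
    (h : IsFiniteLength R W) : gammaSub (maximalIdeal R) W = ⊤ := by
  obtain ⟨_, _⟩ := isFiniteLength_iff_isNoetherian_isArtinian.1 h
  obtain ⟨n, hn⟩ := IsArtinian.monotone_stabilizes (R := R) (M := W)
    ⟨fun n => OrderDual.toDual (maximalIdeal R ^ n • (⊤ : Submodule R W)),
      fun a b hab => Submodule.smul_mono_left (Ideal.pow_le_pow_right hab)⟩
  have h1 : maximalIdeal R ^ n • (⊤ : Submodule R W) = maximalIdeal R ^ (n + 1) • ⊤ :=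
    hn (n + 1) (Nat.le_succ n)
  have h2 : maximalIdeal R ^ n • (⊤ : Submodule R W) = ⊥ := by
    refine Submodule.eq_bot_of_le_smul_of_le_jacobson_bot (maximalIdeal R) _
      (IsNoetherian.noetherian _) ?_
      (IsLocalRing.jacobson_eq_maximalIdeal _ bot_ne_top).ge
    rw [← mul_smul, ← pow_succ', ← h1]
  rw [eq_top_iff]
  intro x _
  refine ⟨n, fun a ha => ?_⟩
  exact (Submodule.mem_bot R).1 (h2 ▸ Submodule.smul_mem_smul ha Submodule.mem_top)

lemma isFiniteLength_iff_gammaSub_eq_top {W : Type} [AddCommGroup W] [Module R W]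
    [Module.Finite R W] : IsFiniteLength R W ↔ gammaSub (maximalIdeal R) W = ⊤ := by
  refine ⟨gammaSub_eq_top_of_isFiniteLength, fun h => ?_⟩
  obtain ⟨k, hk⟩ := exists_pow_smul_eq_zero_of_fg _ h
  exact isFiniteLength_of_pow_smul_eq_zero hk

lemma isFiniteLength_gammaSub (W : Type) [AddCommGroup W] [Module R W] [Module.Finite R W] :
    IsFiniteLength R (gammaSub (maximalIdeal R) W) :=
  isFiniteLength_iff_gammaSub_eq_top.2 (gammaSub_gammaSub _)

lemma mPrimary_of_isFiniteLength {Q : Ideal R} (hQ : Q ≤ maximalIdeal R)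
    (h : IsFiniteLength R (R ⧸ Q)) : MPrimary Q := by
  obtain ⟨k, hk⟩ := exists_pow_smul_eq_zero_of_fg _ (gammaSub_eq_top_of_isFiniteLength h)
  refine ⟨hQ, k, fun a ha => ?_⟩
  have := hk a ha 1
  rwa [Algebra.smul_def, mul_one, Ideal.Quotient.algebraMap_eq, Ideal.Quotient.eq_zero_iff_mem]
    at this

omit [IsNoetherianRing R] in
lemma MPrimary.le_jacobson {Q : Ideal R} (hQ : MPrimary Q) : Q ≤ Ideal.jacobson ⊥ :=
  hQ.1.trans (IsLocalRing.jacobson_eq_maximalIdeal _ bot_ne_top).ge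

omit [IsNoetherianRing R] in
lemma MPrimary.exists_pow_le {Q : Ideal R} (hQ : MPrimary Q) (n : ℕ) :
    ∃ k, maximalIdeal R ^ k ≤ Q ^ n := by
  obtain ⟨k, hk⟩ := hQ.2
  exact ⟨k * n, by rw [pow_mul]; exact Ideal.pow_right_mono hk n⟩

variable {W : Type} [AddCommGroup W] [Module R W]

lemma MPrimary.isFiniteLength_of_pow_smul {Q : Ideal R} (hQ : MPrimary Q) [Module.Finite R W]
    {n : ℕ} (h : ∀ a ∈ Q ^ n, ∀ x : W, a • x = 0) : IsFiniteLength R W := by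
  obtain ⟨k, hk⟩ := hQ.exists_pow_le n
  exact isFiniteLength_of_pow_smul_eq_zero fun a ha => h a (hk ha)

lemma MPrimary.isFiniteLength_quotient {Q : Ideal R} (hQ : MPrimary Q) [Module.Finite R W]
    {n : ℕ} {N : Submodule R W} (hN : Q ^ n • ⊤ ≤ N) : IsFiniteLength R (W ⧸ N) := by
  refine hQ.isFiniteLength_of_pow_smul (n := n) fun a ha x => ?_
  obtain ⟨x, rfl⟩ := Submodule.Quotient.mk_surjective _ x
  rw [← Submodule.Quotient.mk_smul, Submodule.Quotient.mk_eq_zero]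
  exact hN (Submodule.smul_mem_smul ha Submodule.mem_top)

/-- The Hilbert–Samuel function of `W` with respect to `Q`. -/
noncomputable def hilb (Q : Ideal R) (W : Type) [AddCommGroup W] [Module R W] (n : ℕ) : ℕ :=
  (Module.length R (W ⧸ (Q ^ n • (⊤ : Submodule R W)))).toNat

lemma MPrimary.coe_hilb {Q : Ideal R} (hQ : MPrimary Q) [Module.Finite R W] (n : ℕ) :
    (hilb Q W n : ℕ∞) = Module.length R (W ⧸ (Q ^ n • (⊤ : Submodule R W))) :=
  ENat.natCast_toNat (Module.length_ne_top_iff.2 (hQ.isFiniteLength_quotient le_rfl))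

lemma MPrimary.hilb_mono {Q : Ideal R} (hQ : MPrimary Q) (W : Type) [AddCommGroup W] [Module R W]
    [Module.Finite R W] : Monotone (hilb Q W) := by
  intro a b hab
  rw [← Nat.cast_le (α := ℕ∞), hQ.coe_hilb, hQ.coe_hilb]
  exact Module.length_le_of_surjective
    (Submodule.factor (Submodule.smul_mono_left (Ideal.pow_le_pow_right hab)))
    (Submodule.factor_surjective _)

omit [IsLocalRing R] [IsNoetherianRing R] in
lemma hilb_eq_of_equiv (Q : Ideal R) {W' : Type} [AddCommGroup W'] [Module R W'] (e : W ≃ₗ[R] W') :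
    hilb Q W = hilb Q W' := by
  funext n
  rw [hilb, hilb]
  refine congrArg _ (LinearEquiv.length_eq (Submodule.Quotient.equiv _ _ e ?_))
  rw [Submodule.map_smul'', Submodule.map_top, LinearEquiv.range]

end Lengths

section Generic

lemma exists_pow_smul_eq_zero_of_associatedPrimes {S G : Type} [CommRing S] [IsNoetherianRing S]
    [AddCommGroup G] [Module S G] [Module.Finite S G] (s : S) (I : Ideal S)
    (h : ∀ P ∈ associatedPrimes S G, s ∈ P → I ≤ P) :
    ∃ c, ∀ a ∈ I ^ c, ∀ z : G, s • z = 0 → a • z = 0 := by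
  let K := LinearMap.ker (LinearMap.lsmul S G s)
  have hK : I ≤ (Module.annihilator S K).radical := by
    rw [← Ideal.sInf_minimalPrimes]
    refine le_sInf fun P hP => ?_
    refine h P ?_ (hP.1.2 (Module.mem_annihilator.2 fun z => Subtype.ext z.2))
    exact associatedPrimes.subset_of_injective (Submodule.subtype_injective K)
      (Module.associatedPrimes.minimalPrimes_annihilator_subset_associatedPrimes S K hP)
  obtain ⟨c, hc⟩ := Ideal.exists_pow_le_of_le_radical_of_fg hK (IsNoetherian.noetherian I)
  refine ⟨c, fun a ha z hz => ?_⟩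
  have := Module.mem_annihilator.1 (hc ha) ⟨z, hz⟩
  exact congrArg Subtype.val this

lemma exists_finite_pow_smul_mem {S G : Type} [CommRing S] [IsNoetherianRing S]
    [AddCommGroup G] [Module S G] (A B : Submodule S G) (hA : A.FG) :
    ∃ T : Set (Ideal S), T.Finite ∧ ∀ (s : S) (I : Ideal S), (∀ P ∈ T, s ∈ P → I ≤ P) →
      ∃ c, ∀ a ∈ I ^ c, ∀ z ∈ A, s • z ∈ B → a • z ∈ B := by
  have : Module.Finite S A := Module.Finite.iff_fg.2 hA
  refine ⟨associatedPrimes S (A ⧸ B.submoduleOf A), associatedPrimes.finite _ _, fun s I h => ?_⟩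
  obtain ⟨c, hc⟩ := exists_pow_smul_eq_zero_of_associatedPrimes s I h
  refine ⟨c, fun a ha z hz hsz => ?_⟩
  have := hc a ha (Submodule.Quotient.mk ⟨z, hz⟩)
    ((Submodule.Quotient.mk_eq_zero (B.submoduleOf A)).2 hsz)
  exact (Submodule.Quotient.mk_eq_zero (B.submoduleOf A)).1 this

variable {R : Type} [CommRing R]

/-- `P` holds for all elements of `Q` that avoid finitely many ideals not containing `Q`. -/
def Generic (Q : Ideal R) (P : R → Prop) : Prop :=
  ∃ s : Set (Ideal R), s.Finite ∧ (∀ p ∈ s, ¬ Q ≤ p) ∧ ∀ h ∈ Q, (∀ p ∈ s, h ∉ p) → P h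

lemma Generic.mono {Q : Ideal R} {P P' : R → Prop} (h : Generic Q P) (hP : ∀ x ∈ Q, P x → P' x) :
    Generic Q P' := by
  obtain ⟨s, hs, hs', h⟩ := h
  exact ⟨s, hs, hs', fun x hx hxs => hP x hx (h x hx hxs)⟩

lemma Generic.and {Q : Ideal R} {P P' : R → Prop} (h : Generic Q P) (h' : Generic Q P') :
    Generic Q fun x => P x ∧ P' x := by
  obtain ⟨s, hs, hs', h⟩ := h
  obtain ⟨t, ht, ht', h'⟩ := h'
  refine ⟨s ∪ t, hs.union ht, fun p hp => hp.elim (hs' p) (ht' p), fun x hx hxs => ?_⟩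
  exact ⟨h x hx fun p hp => hxs p (Or.inl hp), h' x hx fun p hp => hxs p (Or.inr hp)⟩

lemma Generic.of_forall {Q : Ideal R} {P : R → Prop} (h : ∀ x ∈ Q, P x) : Generic Q P :=
  ⟨∅, Set.finite_empty, by simp, fun x hx _ => h x hx⟩

lemma Generic.forall_lt {Q : Ideal R} (n : ℕ) {P : ℕ → R → Prop} (h : ∀ i < n, Generic Q (P i)) :
    Generic Q fun x => ∀ i < n, P i x := by
  induction n with
  | zero => exact Generic.of_forall (by simp)
  | succ n ih =>
    refine ((ih fun i hi => h i (by omega)).and (h n (by omega))).mono fun x _ hx i hi => ?_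
    rcases Nat.lt_succ_iff_lt_or_eq.1 hi with hi | rfl
    · exact hx.1 i hi
    · exact hx.2

lemma Generic.exists [IsLocalRing R] [IsNoetherianRing R] [Infinite (ResidueField R)] {Q : Ideal R}
    {P : R → Prop} (h : Generic Q P) : ∃ x ∈ Q, P x := by
  obtain ⟨s, hs, hs', h⟩ := h
  let V := Q ⧸ (maximalIdeal R • ⊤ : Submodule R Q)
  have : Infinite (R ⧸ maximalIdeal R) := ‹Infinite (ResidueField R)›
  let _ : Field (R ⧸ maximalIdeal R) := Ideal.Quotient.field _
  let T : Ideal R → Subspace (R ⧸ maximalIdeal R) V := fun p =>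
    { carrier := (Submodule.comap Q.subtype p).map (Submodule.mkQ (maximalIdeal R • ⊤))
      add_mem' := fun ha hb => Submodule.add_mem _ ha hb
      zero_mem' := Submodule.zero_mem _
      smul_mem' := by
        rintro c x hx
        obtain ⟨c, rfl⟩ := Ideal.Quotient.mk_surjective c
        exact Submodule.smul_mem ((Submodule.comap Q.subtype p).map
          (Submodule.mkQ (maximalIdeal R • ⊤ : Submodule R Q))) c hx }
  have hT : ∀ p x, Submodule.Quotient.mk x ∈ T p ↔
      Submodule.mkQ _ x ∈ (Submodule.comap Q.subtype p).map
        (Submodule.mkQ (maximalIdeal R • ⊤ : Submodule R Q)) := fun p x => Iff.rfl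
  have htop : ∀ p ∈ s, T p ≠ ⊤ := by
    intro p hp htop
    apply hs' p hp
    have h1 : (⊤ : Submodule R Q) ≤ Submodule.comap Q.subtype p := by
      refine Submodule.le_of_le_smul_of_le_jacobson_bot (I := maximalIdeal R)
        (IsNoetherian.noetherian _) (IsLocalRing.jacobson_eq_maximalIdeal _ bot_ne_top).ge ?_
      intro x _
      have : Submodule.Quotient.mk x ∈ T p := htop ▸ Submodule.mem_top
      rw [hT] at this
      rw [← Submodule.mem_comap, Submodule.comap_map_mkQ] at this
      rwa [sup_comm]
    intro x hx
    exact h1 (x := ⟨x, hx⟩) trivial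
  obtain ⟨y, hy⟩ := (Set.ne_univ_iff_exists_notMem _).1
    (Subspace.biUnion_ne_univ_of_top_notMem (s := (hs.image T).toFinset) (by
      rw [Set.Finite.mem_toFinset]
      rintro ⟨p, hp, h⟩
      exact htop p hp h))
  obtain ⟨x, rfl⟩ := Submodule.Quotient.mk_surjective _ y
  refine ⟨x, x.2, h x x.2 fun p hp hxp => hy ?_⟩
  simp only [Set.mem_iUnion]
  exact ⟨T p, by simpa using ⟨p, hp, rfl⟩, ⟨x, hxp, rfl⟩⟩

end Generic

section Superficial

variable {R : Type} [CommRing R]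

/-- The defining property of a superficial element for `W` with respect to `Q`. -/
def SuperficialOn (Q : Ideal R) (W : Type) [AddCommGroup W] [Module R W] (h : R) : Prop :=
  ∃ c, ∀ n ≥ c, ∀ x ∈ Q ^ c • (⊤ : Submodule R W), h • x ∈ Q ^ (n + 1) • (⊤ : Submodule R W) →
    x ∈ Q ^ n • (⊤ : Submodule R W)

variable {W : Type} [AddCommGroup W] [Module R W]

lemma superficialOn_of_step {Q : Ideal R} {h : R} (c : ℕ)
    (H : ∀ n ≥ c, ∀ x ∈ Q ^ n • (⊤ : Submodule R W), h • x ∈ Q ^ (n + 2) • (⊤ : Submodule R W) →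
      x ∈ Q ^ (n + 1) • (⊤ : Submodule R W)) : SuperficialOn Q W h := by
  refine ⟨c, fun n hn => ?_⟩
  obtain ⟨k, rfl⟩ := Nat.exists_eq_add_of_le hn
  intro x hx hhx
  have key : ∀ j ≤ k, x ∈ Q ^ (c + j) • (⊤ : Submodule R W) := by
    intro j
    induction j with
    | zero => exact fun _ => hx
    | succ j ih =>
      intro hj
      refine H _ (Nat.le_add_right _ _) x (ih (by omega)) ?_
      exact Submodule.smul_mono_left (Ideal.pow_le_pow_right (by omega)) hhx
  exact key k le_rfl

/-- The filtration `Qⁿ⁺¹W`. -/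
def shiftFiltration (Q : Ideal R) (W : Type) [AddCommGroup W] [Module R W] : Q.Filtration W where
  N n := Q ^ (n + 1) • ⊤
  mono n := Submodule.smul_mono_left (Ideal.pow_le_pow_right (by omega))
  smul_le n := by rw [← mul_smul, ← pow_succ']

/-- The filtration `Qⁿ⁺²W : h` on `QⁿW`. -/
def colonFiltration (Q : Ideal R) (W : Type) [AddCommGroup W] [Module R W] (h : R) :
    Q.Filtration W where
  N n := Q ^ n • ⊤ ⊓ (Q ^ (n + 2) • ⊤ : Submodule R W).comap (LinearMap.lsmul R W h)
  mono n := inf_le_inf (Submodule.smul_mono_left (Ideal.pow_le_pow_right (by omega)))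
    (Submodule.comap_mono (Submodule.smul_mono_left (Ideal.pow_le_pow_right (by omega))))
  smul_le n := by
    refine Submodule.smul_le.2 fun r hr x hx => ⟨?_, ?_⟩
    · rw [pow_succ', mul_smul]
      exact Submodule.smul_mem_smul hr hx.1
    · rw [SetLike.mem_coe, Submodule.mem_comap, map_smul, show n + 1 + 2 = (n + 2) + 1 by ring, pow_succ', mul_smul]
      exact Submodule.smul_mem_smul hr hx.2

/-- The element `a X` of the Rees algebra. -/
noncomputable def reesOne (Q : Ideal R) : Q →ₗ[R] reesAlgebra Q :=
  LinearMap.codRestrict (Subalgebra.toSubmodule (reesAlgebra Q))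
    ((Polynomial.monomial 1 : R →ₗ[R] Polynomial R) ∘ₗ Q.subtype)
    fun a => reesAlgebra.monomial_mem.2 (by simp)

lemma exists_mem_span_reesOne_pow (Q : Ideal R) (c : ℕ) (a : R) (ha : a ∈ Q ^ c) :
    ∃ p ∈ Ideal.span (Set.range (reesOne Q)) ^ c, (p : Polynomial R) = Polynomial.monomial c a := by
  induction c generalizing a with
  | zero => exact ⟨algebraMap R _ a, by simp, rfl⟩
  | succ c ih =>
    rw [pow_succ'] at ha
    induction ha using Submodule.mul_induction_on' with
    | mem_mul_mem b hb d hd =>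
      obtain ⟨p, hp, hpd⟩ := ih d hd
      refine ⟨reesOne Q ⟨b, hb⟩ * p, ?_, ?_⟩
      · rw [pow_succ']
        exact Ideal.mul_mem_mul (Ideal.subset_span ⟨_, rfl⟩) hp
      · have : (reesOne Q ⟨b, hb⟩ : Polynomial R) = Polynomial.monomial 1 b := rfl
        rw [Subalgebra.coe_mul, this, hpd, Polynomial.monomial_mul_monomial, add_comm]
    | add x _ y _ hx hy =>
      obtain ⟨p, hp, hpx⟩ := hx
      obtain ⟨q, hq, hqy⟩ := hy
      exact ⟨p + q, Ideal.add_mem _ hp hq, by rw [Subalgebra.coe_add, hpx, hqy, map_add]⟩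

lemma superficialOn_of_annihilation [IsNoetherianRing R] [Module.Finite R W] {Q : Ideal R} {h : R}
    (c : ℕ) (H : ∀ a ∈ Q ^ c, ∀ n, ∀ x ∈ Q ^ n • (⊤ : Submodule R W),
      h • x ∈ Q ^ (n + 2) • (⊤ : Submodule R W) → a • x ∈ Q ^ (n + c + 1) • (⊤ : Submodule R W)) :
    SuperficialOn Q W h := by
  have hle : colonFiltration Q W h ≤ Q.stableFiltration ⊤ := fun n => inf_le_left
  obtain ⟨n₀, hn₀⟩ := ((Q.stableFiltration_stable ⊤).of_le hle).exists_pow_smul_eq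
  refine superficialOn_of_step (n₀ + c) fun n hn x hx hhx => ?_
  obtain ⟨k, rfl⟩ := Nat.exists_eq_add_of_le hn
  have h1 : x ∈ (colonFiltration Q W h).N (n₀ + k + c) := by
    rw [show n₀ + k + c = n₀ + c + k by ring]
    exact ⟨hx, hhx⟩
  have h2 : (colonFiltration Q W h).N (n₀ + k + c) =
      Q ^ c • (colonFiltration Q W h).N (n₀ + k) := by
    rw [hn₀, ← mul_smul, ← pow_add, ← hn₀]
    congr 1; ring
  rw [h2] at h1
  rw [show n₀ + c + k + 1 = n₀ + k + c + 1 by ring]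
  refine Submodule.smul_le.2 (fun a ha y hy => ?_) h1
  exact H a ha _ y (Submodule.mem_inf.1 hy).1 (Submodule.mem_inf.1 hy).2

theorem generic_superficialOn [IsNoetherianRing R] (Q : Ideal R) (W : Type) [AddCommGroup W]
    [Module R W] [Module.Finite R W] : Generic Q (SuperficialOn Q W) := by
  let A := (Q.stableFiltration (⊤ : Submodule R W)).submodule
  have hA : A.FG := (Ideal.Filtration.submodule_fg_iff_stable _
    fun i => IsNoetherian.noetherian _).2 (Q.stableFiltration_stable ⊤)
  obtain ⟨T, hfin, hT⟩ := exists_finite_pow_smul_mem A (shiftFiltration Q W).submodule hA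
  let I := Ideal.span (Set.range (reesOne Q))
  let pr : Ideal (reesAlgebra Q) → Ideal R := fun P =>
    ((P.restrictScalars R).comap (reesOne Q)).map Q.subtype
  refine ⟨pr '' {P ∈ T | ¬ I ≤ P},
    (hfin.subset (Set.sep_subset _ _)).image _, ?_, ?_⟩
  · rintro _ ⟨P, ⟨-, hP⟩, rfl⟩ hQ
    apply hP
    rw [Ideal.span_le]
    rintro _ ⟨a, rfl⟩
    obtain ⟨b, hb, hba⟩ := hQ a.2
    rwa [Subtype.ext hba] at hb
  · intro h hh hs
    obtain ⟨c, hc⟩ := hT (reesOne Q ⟨h, hh⟩) I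
      fun P hP hhP => by
        by_contra hIP
        exact hs _ ⟨P, ⟨hP, hIP⟩, rfl⟩ ⟨⟨h, hh⟩, hhP, rfl⟩
    refine superficialOn_of_annihilation c fun a ha n x hx hhx => ?_
    have hxA : PolynomialModule.single R n x ∈ A := by
      intro i
      rw [PolynomialModule.coeff_single, Finsupp.single_apply]
      split_ifs with hi
      · exact hi ▸ hx
      · exact Submodule.zero_mem _
    have hmem : ∀ (p : reesAlgebra Q) (m : ℕ) (b : R), (p : Polynomial R) = Polynomial.monomial m b →
        (p • PolynomialModule.single R n x ∈ (shiftFiltration Q W).submodule ↔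
          b • x ∈ Q ^ (n + m + 1) • (⊤ : Submodule R W)) := by
      intro p m b hp
      rw [Subalgebra.smul_def, hp, PolynomialModule.monomial_smul_single,
        Ideal.Filtration.mem_submodule]
      simp only [PolynomialModule.coeff_single, Finsupp.single_apply]
      constructor
      · intro H
        have := H (m + n)
        rwa [if_pos rfl, add_comm m] at this
      · intro H i
        split_ifs with hi
        · rw [← hi, add_comm m]; exact H
        · exact Submodule.zero_mem _
    obtain ⟨p, hp, hpa⟩ := exists_mem_span_reesOne_pow Q c a ha
    exact (hmem p c a hpa).1 (hc p hp _ hxA ((hmem (reesOne Q ⟨h, hh⟩) 1 h rfl).2 hhx))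

end Superficial

lemma partialSum_le_of_step {f g : ℕ → ℕ} (hf : Monotone f) {t n₀ : ℕ}
    (h : ∀ n ≥ n₀, g (n + 1) + f n ≤ f (n + 1) + t) :
    ∃ b, ∀ n, partialSum g n ≤ f n + t * n + b := by
  have hmono : Monotone (partialSum g) := by
    refine monotone_nat_of_le_succ fun n => ?_
    rw [partialSum, partialSum, Finset.sum_range_succ]
    exact Nat.le_add_right _ _
  have key : ∀ k, partialSum g (n₀ + k + 1) ≤ f (n₀ + k) + t * (n₀ + k) + partialSum g (n₀ + 1) := by
    intro k
    induction k with
    | zero => exact Nat.le_add_left _ _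
    | succ k ih =>
      have h1 : partialSum g (n₀ + k + 1 + 1) = partialSum g (n₀ + k + 1) + g (n₀ + k + 1) :=
        Finset.sum_range_succ _ _
      have h2 := h (n₀ + k) (Nat.le_add_right _ _)
      have h3 : n₀ + (k + 1) = n₀ + k + 1 := rfl
      rw [h3, h1, mul_add t, mul_one]
      omega
  refine ⟨partialSum g (n₀ + 1), fun n => ?_⟩
  rcases le_total n (n₀ + 1) with hn | hn
  · exact (hmono hn).trans (Nat.le_add_left _ _)
  · obtain ⟨k, rfl⟩ := Nat.exists_eq_add_of_le hn
    have h1 := key k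
    have h2 : n₀ + 1 + k = n₀ + k + 1 := by omega
    have h3 := hf (Nat.le_succ (n₀ + k))
    rw [h2, mul_add t, mul_one]
    change f (n₀ + k) ≤ f (n₀ + k + 1) at h3
    omega

section ModBy

variable {R : Type} [CommRing R]

/-- The quotient `M / hM`. -/
abbrev ModBy (h : R) (M : Type) [AddCommGroup M] [Module R M] : Type :=
  M ⧸ LinearMap.range (LinearMap.lsmul R M h)

variable {M : Type} [AddCommGroup M] [Module R M] {Q : Ideal R} {h : R}

lemma SuperficialOn.exists_pow_smul_eq_zero [IsLocalRing R] [IsNoetherianRing R]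
    [Module.Finite R M] (hQ : Q ≤ maximalIdeal R) (hs : SuperficialOn Q M h) :
    ∃ c, ∀ x : M, h • x = 0 → x ∈ Q ^ c • (⊤ : Submodule R M) → x = 0 := by
  obtain ⟨c, hc⟩ := hs
  refine ⟨c, fun x hx hxc => ?_⟩
  have : x ∈ (⨅ i : ℕ, Q ^ i • ⊤ : Submodule R M) := by
    rw [Submodule.mem_iInf]
    intro i
    have h1 := hc (c + i) (Nat.le_add_right _ _) x hxc (hx ▸ Submodule.zero_mem _)
    exact Submodule.smul_mono_left (Ideal.pow_le_pow_right (Nat.le_add_left _ _)) h1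
  rwa [Ideal.iInf_pow_smul_eq_bot_of_isLocalRing _ _, Submodule.mem_bot] at this
  rintro rfl
  exact (maximalIdeal.isMaximal R).ne_top (top_le_iff.1 hQ)

lemma SuperficialOn.ker_le_gammaSub [IsLocalRing R] [IsNoetherianRing R]
    [Module.Finite R M] (hQ : MPrimary Q) (hs : SuperficialOn Q M h) :
    LinearMap.ker (LinearMap.lsmul R M h) ≤ gammaSub (maximalIdeal R) M := by
  obtain ⟨c, hc⟩ := hs.exists_pow_smul_eq_zero hQ.1
  obtain ⟨k, hk⟩ := hQ.exists_pow_le c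
  refine fun x hx => ⟨k, fun a ha => hc _ ?_ (Submodule.smul_mem_smul (hk ha) Submodule.mem_top)⟩
  have hx : h • x = 0 := hx
  rw [smul_comm, hx, smul_zero]

lemma exact_mapQ_modBy (h : R) (N N' : Submodule R M)
    (hN : N ≤ N'.comap (LinearMap.lsmul R M h)) :
    Function.Exact (N.mapQ N' (LinearMap.lsmul R M h) hN)
      (N'.mapQ (N'.map (LinearMap.range (LinearMap.lsmul R M h)).mkQ)
        (LinearMap.range (LinearMap.lsmul R M h)).mkQ (Submodule.le_comap_map _ _)) := by
  intro y
  obtain ⟨y, rfl⟩ := Submodule.Quotient.mk_surjective _ y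
  rw [Submodule.mapQ_apply, Submodule.Quotient.mk_eq_zero]
  constructor
  · rintro ⟨z, hz, hzy⟩
    rw [Submodule.mkQ_apply, Submodule.mkQ_apply, Submodule.Quotient.eq] at hzy
    obtain ⟨w, hw⟩ := hzy
    refine ⟨Submodule.Quotient.mk (-w), ?_⟩
    rw [Submodule.mapQ_apply, Submodule.Quotient.eq, map_neg, hw]
    simpa using N'.neg_mem hz
  · rintro ⟨w, hw⟩
    obtain ⟨w, rfl⟩ := Submodule.Quotient.mk_surjective _ w
    rw [Submodule.mapQ_apply, Submodule.Quotient.eq] at hw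
    refine ⟨-(h • w - y), N'.neg_mem hw, ?_⟩
    rw [Submodule.mkQ_apply, Submodule.mkQ_apply, Submodule.Quotient.eq]
    exact ⟨-w, by simp⟩

/-- For large `n`, an element multiplied by `h` into `Qⁿ⁺¹M` lies in `QⁿM + (0 : h)`. -/
lemma SuperficialOn.exists_mem_sup_ker [IsNoetherianRing R] [Module.Finite R M]
    (hs : SuperficialOn Q M h) : ∃ n₀, ∀ n ≥ n₀, ∀ x, h • x ∈ Q ^ (n + 1) • (⊤ : Submodule R M) →
      ∃ y ∈ Q ^ n • (⊤ : Submodule R M), h • (x - y) = 0 := by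
  obtain ⟨c, hc⟩ := hs
  obtain ⟨k, hk⟩ := Q.exists_pow_inf_eq_pow_smul (LinearMap.range (LinearMap.lsmul R M h))
  refine ⟨c + k, fun n hn x hx => ?_⟩
  have h1 : h • x ∈ Q ^ (n + 1 - k) • (Q ^ k • ⊤ ⊓ LinearMap.range (LinearMap.lsmul R M h)) := by
    rw [← hk (n + 1) (by omega)]
    exact ⟨hx, x, rfl⟩
  have h2 : h • x ∈ (Q ^ c • (⊤ : Submodule R M)).map (LinearMap.lsmul R M h) := by
    rw [Submodule.map_smul'', Submodule.map_top]
    exact Submodule.smul_mono (Ideal.pow_le_pow_right (by omega)) inf_le_right h1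
  obtain ⟨y, hy, hxy⟩ := h2
  have hxy : h • y = h • x := hxy
  refine ⟨y, hc n (by omega) y hy (hxy ▸ hx), ?_⟩
  rw [smul_sub, hxy, sub_self]

variable [IsLocalRing R] [IsNoetherianRing R] [Module.Finite R M]

lemma SuperficialOn.hilb_modBy_add_le (hQ : MPrimary Q) (hh : h ∈ Q) (hs : SuperficialOn Q M h)
    {t : ℕ} (ht : Module.length R (LinearMap.ker (LinearMap.lsmul R M h)) ≤ t) :
    ∃ n₀, ∀ n ≥ n₀, hilb Q (ModBy h M) (n + 1) + hilb Q M n ≤ hilb Q M (n + 1) + t := by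
  obtain ⟨n₀, hn₀⟩ := hs.exists_mem_sup_ker
  refine ⟨n₀, fun n hn => ?_⟩
  have hN : Q ^ n • ⊤ ≤ (Q ^ (n + 1) • ⊤ : Submodule R M).comap (LinearMap.lsmul R M h) := by
    intro x hx
    rw [Submodule.mem_comap, pow_succ', mul_smul]
    exact Submodule.smul_mem_smul hh hx
  set φ := (Q ^ n • ⊤ : Submodule R M).mapQ _ (LinearMap.lsmul R M h) hN with hφ
  have e1 := exact_mapQ_modBy h _ _ hN
  rw [← hφ] at e1
  set ψ := (Q ^ (n + 1) • ⊤ : Submodule R M).mapQ _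
    (LinearMap.range (LinearMap.lsmul R M h)).mkQ (Submodule.le_comap_map _ _)
  have hψ : Function.Surjective ψ := by
    intro y
    obtain ⟨y, rfl⟩ := Submodule.Quotient.mk_surjective _ y
    obtain ⟨y, rfl⟩ := Submodule.Quotient.mk_surjective _ y
    exact ⟨Submodule.Quotient.mk y, rfl⟩
  have l1 := Module.length_eq_add_of_exact (LinearMap.range φ).subtype ψ
    (Submodule.subtype_injective _) hψ (by
      rw [LinearMap.exact_iff, e1.linearMap_ker_eq, Submodule.range_subtype])
  have e2 : Function.Exact ((Q ^ n • ⊤ : Submodule R M).mkQ ∘ₗ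
      (LinearMap.ker (LinearMap.lsmul R M h)).subtype) φ.rangeRestrict := by
    rw [LinearMap.exact_iff, LinearMap.ker_rangeRestrict]
    ext x
    obtain ⟨x, rfl⟩ := Submodule.Quotient.mk_surjective _ x
    constructor
    · intro hx
      rw [LinearMap.mem_ker, hφ, Submodule.mapQ_apply, Submodule.Quotient.mk_eq_zero] at hx
      obtain ⟨y, hy, hxy⟩ := hn₀ n hn x hx
      refine ⟨⟨x - y, hxy⟩, ?_⟩
      exact (Submodule.Quotient.eq _).2 (by simpa using Submodule.neg_mem _ hy)
    · rintro ⟨⟨y, hy⟩, hyx⟩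
      rw [← hyx]
      have hy : h • y = 0 := hy
      change φ (Submodule.Quotient.mk y) = 0
      rw [hφ, Submodule.mapQ_apply, LinearMap.lsmul_apply, hy, Submodule.Quotient.mk_zero]
  have l2 := length_le_of_exact e2
  have l3 : Module.length R (_ ⧸ (Q ^ (n + 1) • ⊤ : Submodule R M).map
      (LinearMap.range (LinearMap.lsmul R M h)).mkQ) = hilb Q (ModBy h M) (n + 1) := by
    rw [hQ.coe_hilb, Submodule.map_smul'', Submodule.map_top, Submodule.range_mkQ]
  rw [l3, ← hQ.coe_hilb] at l1
  rw [← hQ.coe_hilb] at l2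
  rw [← Nat.cast_le (α := ℕ∞)]
  push_cast
  rw [l1]
  calc _ ≤ (hilb Q (ModBy h M) (n + 1) : ℕ∞) + (t + Module.length R (LinearMap.range φ)) := by
        gcongr
        exact l2.trans (by gcongr)
    _ = _ := by ring

lemma SuperficialOn.length_ker_ne_top (hQ : MPrimary Q) (hs : SuperficialOn Q M h) :
    Module.length R (LinearMap.ker (LinearMap.lsmul R M h)) ≠ ⊤ :=
  ne_top_of_le_ne_top (Module.length_ne_top_iff.2 (isFiniteLength_gammaSub M))
    (Module.length_le_of_injective _ (Submodule.inclusion_injective (hs.ker_le_gammaSub hQ)))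

lemma SuperficialOn.growthLE (hQ : MPrimary Q) (hh : h ∈ Q) (hs : SuperficialOn Q M h) {r e : ℕ}
    (hr : 1 ≤ r) (hg : GrowthLE (hilb Q M) (r + 1) e) : GrowthLE (hilb Q (ModBy h M)) r e := by
  obtain ⟨t, ht⟩ := ENat.ne_top_iff_exists.1 (hs.length_ker_ne_top hQ)
  obtain ⟨n₀, hn₀⟩ := hs.hilb_modBy_add_le hQ hh ht.ge
  obtain ⟨b, hb⟩ := partialSum_le_of_step (hQ.hilb_mono M) hn₀
  refine GrowthLE.of_partialSum hr hg (t + b) fun n => (hb n).trans ?_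
  nlinarith

lemma hilb_one_eq (hQ : MPrimary Q) {N : Type} [AddCommGroup N] [Module R N] [Module.Finite R N]
    {b : ℕ} (hb : ∀ n, hilb Q N n ≤ b) : Module.length R N ≤ b := by
  have : ∃ n, Q ^ n • (⊤ : Submodule R N) = ⊥ := by
    by_contra! hne
    have : ∀ n, n ≤ hilb Q N n := by
      intro n
      induction n with
      | zero => exact Nat.zero_le _
      | succ n ih =>
        refine lt_of_le_of_lt ih ?_
        have hlt : Q ^ (n + 1) • (⊤ : Submodule R N) < Q ^ n • ⊤ := by
          refine lt_of_le_of_ne (Submodule.smul_mono_left (Ideal.pow_le_pow_right (by omega))) ?_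
          intro heq
          apply hne n
          refine Submodule.eq_bot_of_le_smul_of_le_jacobson_bot Q _ (IsNoetherian.noetherian _)
            ?_ hQ.le_jacobson
          rw [← mul_smul, ← pow_succ', heq]
        have := hQ.isFiniteLength_quotient (W := N) (n := n + 1) le_rfl
        rw [← Nat.cast_lt (α := ℕ∞), hQ.coe_hilb, hQ.coe_hilb, Module.length_quotient,
          Module.length_quotient]
        refine Order.coheight_strictAnti hlt (lt_top_iff_ne_top.2 ?_)
        rw [← Module.length_quotient]
        exact Module.length_ne_top_iff.2 (hQ.isFiniteLength_quotient le_rfl)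
    have := (this (b + 1)).trans (hb _)
    omega
  obtain ⟨n, hn⟩ := this
  calc Module.length R N = Module.length R (N ⧸ (⊥ : Submodule R N)) :=
        (Submodule.quotEquivOfEqBot _ rfl).symm.length_eq
    _ = hilb Q N n := by rw [hQ.coe_hilb, hn]
    _ ≤ b := by exact_mod_cast hb n

lemma SuperficialOn.length_modBy_le (hQ : MPrimary Q) (hh : h ∈ Q) (hs : SuperficialOn Q M h)
    {e t : ℕ} (hg : GrowthLE (hilb Q M) 1 e)
    (ht : Module.length R (LinearMap.ker (LinearMap.lsmul R M h)) ≤ t) :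
    Module.length R (ModBy h M) ≤ (e + t : ℕ) := by
  obtain ⟨n₀, hn₀⟩ := hs.hilb_modBy_add_le hQ hh ht
  obtain ⟨b, hb⟩ := partialSum_le_of_step (hQ.hilb_mono M) hn₀
  exact hilb_one_eq hQ (hg.le_of_monotone (hQ.hilb_mono _) t b hb)

end ModBy

lemma choose_add_sub_le {m r i : ℕ} (hi : 1 ≤ i) (hir : i ≤ r) :
    (m + r - i).choose (r - i) ≤ r ^ (r - 1) * (m + 2) ^ (r - 1) := by
  have hr : 1 ≤ r := hi.trans hir
  calc (m + r - i).choose (r - i) ≤ (m + r - i) ^ (r - i) := Nat.choose_le_pow _ _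
    _ ≤ (r * (m + 2)) ^ (r - i) := by
      refine Nat.pow_le_pow_left ?_ _
      have : m ≤ r * m := Nat.le_mul_of_pos_left _ hr
      rw [mul_add]
      omega
    _ ≤ (r * (m + 2)) ^ (r - 1) := by
      refine Nat.pow_le_pow_right (Nat.mul_pos hr (by omega)) (by omega)
    _ = _ := mul_pow _ _ _

lemma HasHilbCoeffs.growthLE {R : Type} [CommRing R] [IsLocalRing R] [IsNoetherianRing R]
    {Q : Ideal R} (hQ : MPrimary Q) {M : Type} [AddCommGroup M] [Module R M] [Module.Finite R M]
    {r : ℕ} {s : ℕ → ℤ} {e : ℕ} (hr : 1 ≤ r) (h : HasHilbCoeffs R Q M r s) (he : s 0 = e) :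
    GrowthLE (hilb Q M) r e := by
  obtain ⟨N, hN⟩ := h
  refine ⟨0, r - 1, (∑ i ∈ Finset.range r, (s (i + 1)).natAbs) * r ^ (r - 1) + hilb Q M N,
    fun n => ?_⟩
  simp only [Function.iterate_zero, id, add_zero]
  have h1 : 1 ≤ (n + 1) ^ (r - 1) := Nat.one_le_pow _ _ (by omega)
  rcases le_or_gt n N with hn | hn
  · have := hQ.hilb_mono M hn
    nlinarith [Nat.zero_le (e * (n + (r - 1)).choose r),
      Nat.zero_le ((∑ i ∈ Finset.range r, (s (i + 1)).natAbs) * r ^ (r - 1) * (n + 1) ^ (r - 1)),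
      Nat.mul_le_mul_left (hilb Q M N) h1]
  · obtain ⟨m, rfl⟩ : ∃ m, n = m + 1 := ⟨n - 1, by omega⟩
    obtain ⟨l, hl, hl'⟩ := hN m (by omega)
    have hl2 : hilb Q M (m + 1) = l := by
      have := (mLength_eq_coe_iff l).1 hl
      rw [← hQ.coe_hilb] at this
      exact_mod_cast this
    rw [Finset.sum_range_succ'] at hl'
    simp only [pow_zero, one_mul, Nat.sub_zero, he] at hl'
    have hle : (l : ℤ) ≤ (∑ i ∈ Finset.range r, ((s (i + 1)).natAbs : ℤ) *
        (r ^ (r - 1) * (m + 2) ^ (r - 1) : ℕ)) + e * ((m + r).choose r : ℤ) := by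
      rw [hl']
      refine add_le_add_left (Finset.sum_le_sum fun i hi => ?_) _
      have hc := choose_add_sub_le (m := m) (r := r) (i := i + 1) (by omega)
        (by have := Finset.mem_range.1 hi; omega)
      calc _ ≤ |(-1 : ℤ) ^ (i + 1) * s (i + 1) * ((m + r - (i + 1)).choose (r - (i + 1)) : ℤ)| :=
            le_abs_self _
        _ = ((s (i + 1)).natAbs : ℤ) * ((m + r - (i + 1)).choose (r - (i + 1)) : ℤ) := by
            rw [abs_mul, abs_mul, abs_pow, abs_neg, abs_one, one_pow, one_mul, Nat.abs_cast,
              Int.natCast_natAbs]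
        _ ≤ _ := mul_le_mul_of_nonneg_left (by exact_mod_cast hc) (by positivity)
    rw [← Finset.sum_mul] at hle
    have hle' : l ≤ (∑ i ∈ Finset.range r, (s (i + 1)).natAbs) *
        (r ^ (r - 1) * (m + 2) ^ (r - 1)) + e * (m + r).choose r := by exact_mod_cast hle
    rw [hl2, show m + 1 + (r - 1) = m + r by omega, show m + 1 + 1 = m + 2 by ring]
    nlinarith [Nat.zero_le (hilb Q M N * (m + 2) ^ (r - 1))]

section HD

variable {R : Type} [CommRing R] [IsLocalRing R] (Q : Ideal R)
  (E : Type) [AddCommGroup E] [Module R E]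

/-- `HD Q E r M v`: the natural number `v` bounds the homological degree of `M`, computed as if
`M` had dimension `r`. -/
inductive HD : ℕ → ModuleCat.{0} R → ℕ → Prop where
  | zero (M : ModuleCat.{0} R) (v : ℕ) : Module.length R M ≤ v → HD 0 M v
  | succ (M : ModuleCat.{0} R) (r e v : ℕ) (s w : ℕ → ℕ) : Module.Finite R M →
      GrowthLE (hilb Q M) (r + 1) e → (∀ j ≤ r, s j ≤ j) →
      (∀ j ≤ r, HD (s j) (ModuleCat.of R (LCoh (maximalIdeal R) j M →ₗ[R] E)) (w j)) →
      e + ∑ j ∈ Finset.range (r + 1), r.choose j * w j ≤ v → HD (r + 1) M v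

variable {Q E}

lemma HD.mono {r : ℕ} {M : ModuleCat.{0} R} {v v' : ℕ} (h : HD Q E r M v) (hv : v ≤ v') :
    HD Q E r M v' := by
  cases h with
  | zero _ _ h => exact .zero _ _ (h.trans (by exact_mod_cast hv))
  | succ _ r e _ s w h1 h2 h3 h4 h5 => exact .succ _ r e _ s w h1 h2 h3 h4 (h5.trans hv)

lemma HD.of_equiv {r : ℕ} {M N : ModuleCat.{0} R} {v : ℕ} (h : HD Q E r M v) (f : M ≃ₗ[R] N) :
    HD Q E r N v := by
  induction h generalizing N with
  | zero _ _ h => exact .zero _ _ (f.length_eq ▸ h)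
  | succ M r e v s w h1 h2 h3 h4 h5 ih =>
    exact .succ _ r e _ s w (Module.Finite.equiv f) (hilb_eq_of_equiv Q f ▸ h2) h3
      (fun j hj => ih j hj (LinearEquiv.congrLeft E R (lcohEquiv (maximalIdeal R) j f))) h5

lemma HD.finite {r : ℕ} {M : ModuleCat.{0} R} {v : ℕ} (h : HD Q E r M v) : Module.Finite R M := by
  cases h with
  | zero _ _ h =>
    have := (isFiniteLength_iff_isNoetherian_isArtinian.1
      (Module.length_ne_top_iff.1 (ne_top_of_le_ne_top (ENat.natCast_ne_top v) h))).1
    infer_instance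
  | succ _ r e _ s w h1 => exact h1

variable [IsNoetherianRing R]

lemma HD.length_gammaSub_le (hE : IsInjEnvResidue R E) {r : ℕ} {M : ModuleCat.{0} R} {v : ℕ}
    (h : HD Q E r M v) : Module.length R (gammaSub (maximalIdeal R) M) ≤ v := by
  cases h with
  | zero _ _ h => exact (Module.length_le_of_injective _ (Submodule.subtype_injective _)).trans h
  | succ _ r e _ s w h1 h2 h3 h4 h5 =>
    have h0 := h4 0 (Nat.zero_le _)
    rw [Nat.le_zero.1 (h3 0 (Nat.zero_le _))] at h0
    cases h0 with
    | zero _ _ h0 =>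
      have hf := isFiniteLength_gammaSub (R := R) M
      have he := lcohZeroEquiv (maximalIdeal R) M
      change Module.length R (LCoh (maximalIdeal R) 0 M →ₗ[R] E) ≤ _ at h0
      rw [(LinearEquiv.congrLeft E R he).length_eq, length_dual hE hf] at h0
      refine h0.trans ?_
      rw [Finset.sum_range_succ'] at h5
      simp only [Nat.choose_zero_right, one_mul] at h5
      exact_mod_cast (by omega : w 0 ≤ v)

end HD

section
variable {R : Type} [CommRing R] [IsLocalRing R] [IsNoetherianRing R] {Q : Ideal R}
  {E : Type} [AddCommGroup E] [Module R E]
  {A B C : Type} [AddCommGroup A] [Module R A] [AddCommGroup B] [Module R B]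
  [AddCommGroup C] [Module R C]

lemma length_dual_lcoh_zero (hE : IsInjEnvResidue R E) (M : Type) [AddCommGroup M] [Module R M]
    [Module.Finite R M] :
    Module.length R (LCoh (maximalIdeal R) 0 M →ₗ[R] E) =
      Module.length R (gammaSub (maximalIdeal R) M) := by
  rw [(LinearEquiv.congrLeft E R (lcohZeroEquiv (maximalIdeal R) M)).length_eq,
    length_dual hE (isFiniteLength_gammaSub M)]

omit [IsLocalRing R] [IsNoetherianRing R] in
lemma length_gammaSub_le_of_injective (J : Ideal R) {f : B →ₗ[R] A} (hf : Function.Injective f) :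
    Module.length R (gammaSub J B) ≤ Module.length R (gammaSub J A) :=
  Module.length_le_of_injective (f.restrict fun _ h => gammaSub_map_mem J f h)
    fun _ _ h => Subtype.ext (hf (congrArg Subtype.val h))

lemma hilb_le_of_injective (hQ : MPrimary Q) [Module.Finite R A] [Module.Finite R B]
    {f : B →ₗ[R] A} (hf : Function.Injective f) : ∃ b, ∀ n, hilb Q B n ≤ hilb Q A (n + b) := by
  obtain ⟨b, hb⟩ := Ideal.exists_pow_inf_eq_pow_smul Q (LinearMap.range f)
  refine ⟨b, fun n => ?_⟩
  have hle : Submodule.comap f (Q ^ (n + b) • ⊤) ≤ Q ^ n • ⊤ := by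
    intro x hx
    have h1 : f x ∈ Q ^ (n + b) • ⊤ ⊓ LinearMap.range f := ⟨hx, ⟨x, rfl⟩⟩
    rw [hb _ (Nat.le_add_left _ _), Nat.add_sub_cancel] at h1
    have h2 := smul_mono_right (Q ^ n) (inf_le_right : _ ≤ LinearMap.range f) h1
    rw [← Submodule.map_top, ← Submodule.map_smul''] at h2
    obtain ⟨y, hy, hyx⟩ := h2
    exact hf hyx ▸ hy
  rw [← Nat.cast_le (α := ℕ∞), hQ.coe_hilb, hQ.coe_hilb]
  refine (Module.length_le_of_surjective (Submodule.factor hle)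
    (Submodule.factor_surjective hle)).trans ?_
  refine Module.length_le_of_injective (Submodule.mapQ _ _ f le_rfl) ?_
  rw [← LinearMap.ker_eq_bot, Submodule.ker_mapQ, Submodule.mkQ_map_self]

lemma hilb_le_add_of_exact (hQ : MPrimary Q) [Module.Finite R A] [Module.Finite R B]
    {f : A →ₗ[R] B} {g : B →ₗ[R] C} (h : Function.Exact f g) {c : ℕ}
    (hC : Module.length R C ≤ c) (n : ℕ) : hilb Q B n ≤ hilb Q A n + c := by
  have hf : Q ^ n • (⊤ : Submodule R A) ≤ (Q ^ n • ⊤ : Submodule R B).comap f := by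
    rw [← Submodule.map_le_iff_le_comap, Submodule.map_smul'']
    exact smul_mono_right _ le_top
  rw [← Nat.cast_le (α := ℕ∞), Nat.cast_add, hQ.coe_hilb, hQ.coe_hilb]
  have h1 : Function.Exact ((Q ^ n • ⊤ : Submodule R A).mapQ (Q ^ n • ⊤) f hf)
      ((Q ^ n • ⊤ : Submodule R B).mapQ ((Q ^ n • ⊤ : Submodule R B).map g) g
        (Submodule.le_comap_map _ _)) := by
    intro y
    obtain ⟨y, rfl⟩ := Submodule.Quotient.mk_surjective _ y
    constructor
    · intro hy
      rw [Submodule.mapQ_apply, Submodule.Quotient.mk_eq_zero] at hy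
      obtain ⟨z, hz, hzy⟩ := hy
      obtain ⟨x, hx⟩ := (h (y - z)).1 (by rw [map_sub, hzy, sub_self])
      refine ⟨Submodule.Quotient.mk x, ?_⟩
      rw [Submodule.mapQ_apply, hx, Submodule.Quotient.eq]
      simpa using hz
    · rintro ⟨x, hx⟩
      obtain ⟨x, rfl⟩ := Submodule.Quotient.mk_surjective _ x
      rw [← hx, Submodule.mapQ_apply, Submodule.mapQ_apply, (h _).2 ⟨x, rfl⟩,
        Submodule.Quotient.mk_zero]
  refine (length_le_of_exact h1).trans (add_le_add_right ((Module.length_le_of_surjective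
    (Submodule.mkQ _) (Submodule.mkQ_surjective _)).trans hC) _)

lemma HD.of_injective (hE : IsInjEnvResidue R E) (hQ : MPrimary Q) {s v : ℕ} (hs : s ≤ 1)
    {f : B →ₗ[R] A} (hf : Function.Injective f) (h : HD Q E s (ModuleCat.of R A) v) :
    HD Q E s (ModuleCat.of R B) v := by
  have hA : Module.Finite R A := h.finite
  have hB : Module.Finite R B := Module.Finite.of_injective f hf
  cases h with
  | zero _ _ h => exact .zero _ _ ((Module.length_le_of_injective f hf).trans h)
  | succ _ r e _ s w h1 h2 h3 h4 h5 =>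
    obtain rfl : r = 0 := by omega
    obtain ⟨b, hb⟩ := hilb_le_of_injective hQ hf
    refine .succ _ 0 e _ s w hB (h2.shift b hb) h3 (fun j hj => ?_) h5
    obtain rfl : j = 0 := by omega
    have h0 := h4 0 le_rfl
    rw [Nat.le_zero.1 (h3 0 le_rfl)] at h0 ⊢
    cases h0 with
    | zero _ _ h0 =>
      refine .zero _ _ ?_
      refine le_trans ?_ h0
      change Module.length R (LCoh (maximalIdeal R) 0 B →ₗ[R] E) ≤
        Module.length R (LCoh (maximalIdeal R) 0 A →ₗ[R] E)
      rw [length_dual_lcoh_zero hE, length_dual_lcoh_zero hE]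
      exact length_gammaSub_le_of_injective _ hf

lemma HD.of_exact (hE : IsInjEnvResidue R E) (hQ : MPrimary Q) {s a c : ℕ}
    {f : A →ₗ[R] B} {g : B →ₗ[R] C} (hf : Function.Injective f) (hfg : Function.Exact f g)
    (hg : Function.Surjective g) (hC : Module.length R C ≤ c)
    (h : HD Q E s (ModuleCat.of R A) a) : HD Q E s (ModuleCat.of R B) (a + c) := by
  have hinj := hE.1
  have hA : Module.Finite R A := h.finite
  have hCl : IsFiniteLength R C :=
    Module.length_ne_top_iff.1 (ne_top_of_le_ne_top (ENat.natCast_ne_top c) hC)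
  have hCn := (isFiniteLength_iff_isNoetherian_isArtinian.1 hCl).1
  have hB : Module.Finite R B := by
    have := isNoetherian_of_range_eq_ker f g (LinearMap.exact_iff.1 hfg).symm
    infer_instance
  cases h with
  | zero _ _ h =>
    refine .zero _ _ ((length_le_of_exact hfg).trans ?_)
    rw [Nat.cast_add]
    exact add_le_add h hC
  | succ _ r e _ s w h1 h2 h3 h4 h5 =>
    refine .succ _ r e _ s (fun j => if j = 0 then w 0 + c else w j) hB
      (h2.add_const (by omega) c (hilb_le_add_of_exact hQ hfg hC)) h3 (fun j hj => ?_) ?_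
    · rcases j with _ | j
      · have h0 := h4 0 (Nat.zero_le _)
        rw [Nat.le_zero.1 (h3 0 (Nat.zero_le _))] at h0 ⊢
        cases h0 with
        | zero _ _ h0 =>
          refine .zero _ _ ?_
          change Module.length R (LCoh (maximalIdeal R) 0 A →ₗ[R] E) ≤ _ at h0
          change Module.length R (LCoh (maximalIdeal R) 0 B →ₗ[R] E) ≤ ((w 0 + c : ℕ) : ℕ∞)
          rw [length_dual_lcoh_zero hE] at h0 ⊢
          have hex : Function.Exact
              (f.restrict (p := gammaSub (maximalIdeal R) A) (q := gammaSub (maximalIdeal R) B)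
                fun _ h => gammaSub_map_mem _ f h)
              (g ∘ₗ (gammaSub (maximalIdeal R) B).subtype) := by
            rintro ⟨y, hy⟩
            constructor
            · intro hgy
              obtain ⟨x, rfl⟩ := (hfg y).1 hgy
              refine ⟨⟨x, ?_⟩, rfl⟩
              obtain ⟨n, hn⟩ := hy
              exact ⟨n, fun a ha => hf (by rw [map_smul, hn a ha, map_zero])⟩
            · rintro ⟨x, hx⟩
              exact (hfg y).2 ⟨x, congrArg Subtype.val hx⟩
          rw [Nat.cast_add]
          exact (length_le_of_exact hex).trans (add_le_add h0 hC)
      · simp only [Nat.add_eq_zero_iff, one_ne_zero, and_false, if_false]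
        have hsub := subsingleton_lcoh_of_torsion (maximalIdeal R) j C
          (gammaSub_eq_top_of_isFiniteLength hCl)
        have hsurj : Function.Surjective (lcohMap (maximalIdeal R) (j + 1) f) := fun y =>
          ((lcoh_long_exact (maximalIdeal R) hf hfg hg (j + 1)).1 y).1 (Subsingleton.elim _ _)
        have hj4 := h4 (j + 1) hj
        rcases j with _ | j
        · exact hj4.of_injective hE hQ (h3 1 hj) (lcomp_injective_of_surjective hsurj)
        · have hsub' := subsingleton_lcoh_of_torsion (maximalIdeal R) j C
            (gammaSub_eq_top_of_isFiniteLength hCl)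
          obtain ⟨-, δ, -, hδ⟩ := lcoh_long_exact (maximalIdeal R) hf hfg hg (j + 1)
          have hi : Function.Injective (lcohMap (maximalIdeal R) (j + 2) f) := by
            rw [injective_iff_map_eq_zero]
            intro x hx
            obtain ⟨y, rfl⟩ := (hδ x).1 hx
            rw [Subsingleton.elim y 0, map_zero]
          exact hj4.of_equiv (LinearEquiv.congrLeft E R (LinearEquiv.ofBijective _ ⟨hi, hsurj⟩))
    · rw [Finset.sum_range_succ'] at h5 ⊢
      simp only [Nat.add_eq_zero_iff, one_ne_zero, and_false, if_false, if_true,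
        Nat.choose_zero_right, one_mul] at h5 ⊢
      omega

end

section ModByCohomology

variable {R : Type} [CommRing R] [IsNoetherianRing R] (J : Ideal R)
  {M : Type} [AddCommGroup M] [Module R M] {h : R}

lemma exists_lcoh_modBy_exact
    (hK : gammaSub J (LinearMap.ker (LinearMap.lsmul R M h)) = ⊤) (j : ℕ) :
    ∃ δ : LCoh J j (ModBy h M) →ₗ[R] LCoh J (j + 1) M,
      Function.Exact (lcohMap J j (LinearMap.range (LinearMap.lsmul R M h)).mkQ) δ ∧
        Function.Exact δ (h • (LinearMap.id : LCoh J (j + 1) M →ₗ[R] LCoh J (j + 1) M)) := by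
  set i := (LinearMap.range (LinearMap.lsmul R M h)).subtype
  set p := (LinearMap.lsmul R M h).rangeRestrict
  have hip : i ∘ₗ p = h • LinearMap.id := rfl
  have hp : Function.Surjective p := LinearMap.surjective_rangeRestrict _
  have hexp : Function.Exact (LinearMap.ker (LinearMap.lsmul R M h)).subtype p :=
    LinearMap.exact_iff.2 (by rw [LinearMap.ker_rangeRestrict, Submodule.range_subtype])
  have hsub := fun k => subsingleton_lcoh_of_torsion J k _ hK
  have hpsurj : Function.Surjective (lcohMap J (j + 1) p) := fun y => by
    obtain ⟨-, δ, h1, -⟩ := lcoh_long_exact J (Submodule.subtype_injective _) hexp hp (j + 1)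
    have := hsub (j + 1)
    exact (h1 y).1 (Subsingleton.elim _ _)
  have hpinj : Function.Injective (lcohMap J (j + 1) p) := by
    have h1 := (lcoh_long_exact J (Submodule.subtype_injective _) hexp hp (j + 1)).1
    rw [injective_iff_map_eq_zero]
    intro x hx
    obtain ⟨y, rfl⟩ := (h1 x).1 hx
    have := hsub j
    rw [Subsingleton.elim y 0, map_zero]
  let e := LinearEquiv.ofBijective _ ⟨hpinj, hpsurj⟩
  have hexi : Function.Exact i (LinearMap.range (LinearMap.lsmul R M h)).mkQ :=
    LinearMap.exact_iff.2 (by rw [Submodule.ker_mkQ, Submodule.range_subtype])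
  obtain ⟨-, δ, h1, h2⟩ := lcoh_long_exact J (Submodule.subtype_injective _) hexi
    (Submodule.mkQ_surjective _) j
  refine ⟨e.symm.toLinearMap ∘ₗ δ, fun y => ?_, fun y => ?_⟩
  · rw [← h1 y]
    exact e.symm.map_eq_zero_iff
  · have hy : (h • (LinearMap.id : LCoh J (j + 1) M →ₗ[R] LCoh J (j + 1) M)) y =
        lcohMap J (j + 1) i (e y) := by
      rw [← lcohMap_smul_id, ← hip, lcohMap_comp]
      rfl
    rw [hy, h2 (e y)]
    constructor
    · rintro ⟨x, hx⟩
      exact ⟨x, e.symm_apply_eq.2 hx⟩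
    · rintro ⟨x, hx⟩
      exact ⟨x, e.symm_apply_eq.1 hx⟩

omit [IsNoetherianRing R] in
lemma smul_lcoh_modBy_eq_zero (j : ℕ) (y : LCoh J j (ModBy h M)) : h • y = 0 := by
  have h0 : h • (LinearMap.id : ModBy h M →ₗ[R] ModBy h M) = (0 : R) • LinearMap.id := by
    ext x
    simp only [LinearMap.comp_apply, LinearMap.smul_apply, LinearMap.id_apply, zero_smul]
    rw [← map_smul]
    exact (Submodule.Quotient.mk_eq_zero _).2 ⟨x, rfl⟩
  have := congrArg (fun f => f y) (lcohMap_smul_id J (M := ModBy h M) j h)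
  rw [h0, lcohMap_smul_id] at this
  exact this.symm.trans (zero_smul R y)

lemma exists_dual_modBy_exact (E : Type) [AddCommGroup E] [Module R E] [Module.Injective R E]
    (hK : gammaSub J (LinearMap.ker (LinearMap.lsmul R M h)) = ⊤) (j : ℕ) :
    ∃ (f : ModBy h (LCoh J (j + 1) M →ₗ[R] E) →ₗ[R] (LCoh J j (ModBy h M) →ₗ[R] E))
      (g : (LCoh J j (ModBy h M) →ₗ[R] E) →ₗ[R] (LCoh J j M →ₗ[R] E)),
      Function.Injective f ∧ Function.Exact f g ∧ ∀ y, h • g y = 0 := by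
  obtain ⟨δ, h1, h2⟩ := exists_lcoh_modBy_exact J hK j
  have h1' := exact_lcomp_of_injective (E := E) h1
  have h2' := exact_lcomp_of_injective (E := E) h2
  have hr : LinearMap.range (LinearMap.lsmul R (LCoh J (j + 1) M →ₗ[R] E) h) =
      LinearMap.ker (LinearMap.lcomp R E δ) := by
    rw [LinearMap.exact_iff.1 h2']
    congr 1
    ext φ x
    simp
  refine ⟨Submodule.liftQ _ (LinearMap.lcomp R E δ) hr.le,
    LinearMap.lcomp R E (lcohMap J j (LinearMap.range (LinearMap.lsmul R M h)).mkQ), ?_, ?_, ?_⟩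
  · rw [← LinearMap.ker_eq_bot, Submodule.ker_liftQ_eq_bot _ _ _ hr.ge]
  · rw [LinearMap.exact_iff, Submodule.range_liftQ]
    exact LinearMap.exact_iff.1 h1'
  · intro y
    ext x
    rw [LinearMap.smul_apply, LinearMap.lcomp_apply, ← map_smul, smul_lcoh_modBy_eq_zero, map_zero]
    rfl

end ModByCohomology

section
variable {R : Type} [CommRing R] [IsLocalRing R] [IsNoetherianRing R] {Q : Ideal R}
  {E : Type} [AddCommGroup E] [Module R E]

lemma SuperficialOn.gammaSub_ker {M : Type} [AddCommGroup M] [Module R M] [Module.Finite R M] {h : R}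
    (hQ : MPrimary Q) (hs : SuperficialOn Q M h) :
    gammaSub (maximalIdeal R) (LinearMap.ker (LinearMap.lsmul R M h)) = ⊤ :=
  gammaSub_eq_top_of_injective _
    (Submodule.inclusion_injective (hs.ker_le_gammaSub hQ)) (gammaSub_gammaSub _)

lemma sum_choose_add_le (r : ℕ) (w : ℕ → ℕ) :
    ∑ j ∈ Finset.range (r + 1), r.choose j * (w (j + 1) + w j) ≤
      ∑ j ∈ Finset.range (r + 2), (r + 1).choose j * w j := by
  rw [Finset.sum_range_succ' _ (r + 1)]
  simp only [mul_add, Finset.sum_add_distrib, Nat.choose_succ_succ', add_mul]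
  rw [Finset.sum_range_succ' (fun j => r.choose j * w j),
    Finset.sum_range_succ (fun j => r.choose (j + 1) * w (j + 1))]
  simp [add_assoc]

lemma HD.generic_modBy (hE : IsInjEnvResidue R E) (hQ : MPrimary Q) {r v : ℕ}
    {M : ModuleCat.{0} R} (h : HD Q E r M v) :
    Generic Q fun x => HD Q E (r - 1) (ModuleCat.of R (ModBy x M)) v := by
  have := hE.1
  induction h with
  | zero M v h =>
    exact Generic.of_forall fun x _ => .zero _ _ ((Module.length_le_of_surjective
      (Submodule.mkQ _) (Submodule.mkQ_surjective _)).trans h)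
  | succ M r e v s w h1 h2 h3 h4 h5 ih =>
    have hfin := fun j hj => (h4 j hj).finite
    have hgen := ((generic_superficialOn Q M).and (Generic.forall_lt (r + 1) fun j hj =>
      ih j (Nat.lt_succ_iff.1 hj))).and (Generic.forall_lt (r + 1) (P := fun j => SuperficialOn Q
        (LCoh (maximalIdeal R) j M →ₗ[R] E)) fun j hj => by
          have := hfin j (Nat.lt_succ_iff.1 hj)
          exact generic_superficialOn Q _)
    refine hgen.mono fun x hx ⟨⟨hxM, hxI⟩, hxS⟩ => ?_
    rcases r with _ | r
    · refine .zero _ _ ?_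
      have h0 := h4 0 le_rfl
      rw [Nat.le_zero.1 (h3 0 le_rfl)] at h0
      cases h0 with
      | zero _ _ h0 =>
        change Module.length R (LCoh (maximalIdeal R) 0 M →ₗ[R] E) ≤ _ at h0
        rw [length_dual_lcoh_zero hE] at h0
        refine (hxM.length_modBy_le hQ hx h2 ((Module.length_le_of_injective _
          (Submodule.inclusion_injective (hxM.ker_le_gammaSub hQ))).trans h0)).trans ?_
        have : e + w 0 ≤ v := by simpa using h5
        exact_mod_cast this
    · refine .succ _ r e v (fun j => s (j + 1) - 1) (fun j => w (j + 1) + w j) inferInstance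
        (hxM.growthLE hQ hx (by omega) h2) (fun j hj => by have := h3 (j + 1) (by omega); omega)
        (fun j hj => ?_) ((Nat.add_le_add_left (sum_choose_add_le r w) e).trans h5)
      obtain ⟨f, g, hf, hfg, hg⟩ := exists_dual_modBy_exact (maximalIdeal R) E
        (hxM.gammaSub_ker hQ) j
      refine HD.of_exact hE hQ (g := g.rangeRestrict) hf ?_ (LinearMap.surjective_rangeRestrict _)
        ?_ (hxI (j + 1) (by omega))
      · rw [LinearMap.exact_iff, LinearMap.ker_rangeRestrict]
        exact LinearMap.exact_iff.1 hfg
      · have := hfin j (by omega)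
        have hle : LinearMap.range g ≤ gammaSub (maximalIdeal R) (LCoh (maximalIdeal R) j M →ₗ[R] E) := by
          refine le_trans ?_ ((hxS j (by omega)).ker_le_gammaSub hQ)
          rintro _ ⟨y, rfl⟩
          exact hg y
        exact (Module.length_le_of_injective _ (Submodule.inclusion_injective hle)).trans
          ((h4 j (by omega)).length_gammaSub_le hE)

lemma HD.length_quotient_le [Infinite (ResidueField R)] (hE : IsInjEnvResidue R E)
    (hQ : MPrimary Q) {r v : ℕ} {M : ModuleCat.{0} R} (h : HD Q E r M v) :
    Module.length R (M ⧸ (Q • ⊤ : Submodule R M)) ≤ v := by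
  induction r generalizing M with
  | zero =>
    cases h with
    | zero _ _ h =>
      exact (Module.length_le_of_surjective _ (Submodule.mkQ_surjective _)).trans h
  | succ r ih =>
    obtain ⟨x, hx, hM⟩ := (h.generic_modBy hE hQ).exists
    refine le_trans ?_ (ih hM)
    have hle : LinearMap.range (LinearMap.lsmul R M x) ≤ Q • ⊤ := by
      rintro _ ⟨y, rfl⟩
      exact Submodule.smul_mem_smul hx Submodule.mem_top
    have heq : (Q • (⊤ : Submodule R M)).map (LinearMap.range (LinearMap.lsmul R M x)).mkQ =
        Q • (⊤ : Submodule R (ModBy x M)) := by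
      rw [Submodule.map_smul'', Submodule.map_top, Submodule.range_mkQ]
    exact ((Submodule.quotientQuotientEquivQuotient _ _ hle).symm.trans
      (Submodule.quotEquivOfEq _ _ heq)).length_eq.le

end

section Finiteness

lemma IsPrecomplete.pi_fin {R : Type} [CommRing R] (I : Ideal R) [IsPrecomplete I R] (n : ℕ) :
    IsPrecomplete I (Fin n → R) := by
  refine ⟨fun f hf => ?_⟩
  have hc : ∀ i : Fin n, ∃ L : R, ∀ k, f k i ≡ L [SMOD (I ^ k • ⊤ : Ideal R)] := by
    intro i
    refine IsPrecomplete.prec ‹_› (f := fun k => f k i) fun {a b} hab => ?_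
    have h := hf hab
    rw [SModEq.sub_mem] at h ⊢
    have h2 := Submodule.mem_map_of_mem (f := LinearMap.proj (R := R) (φ := fun _ => R) i) h
    rw [Submodule.map_smul''] at h2
    exact (Submodule.smul_mono le_rfl le_top :
      I ^ a • Submodule.map _ ⊤ ≤ I ^ a • (⊤ : Ideal R)) h2
  choose L hL using hc
  refine ⟨L, fun k => ?_⟩
  rw [SModEq.sub_mem, pi_eq_sum_univ (f k - L)]
  refine Submodule.sum_mem _ fun i _ => Submodule.smul_mem_smul ?_ Submodule.mem_top
  have := (SModEq.sub_mem.1 (hL i k))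
  rwa [smul_eq_mul, Ideal.mul_top] at this

variable {R : Type} [CommRing R] [IsLocalRing R] {h : R}

lemma finite_of_finite_modBy [IsAdicComplete (maximalIdeal R) R] (hh : h ∈ maximalIdeal R)
    (W : Type) [AddCommGroup W] [Module R W] [IsHausdorff (maximalIdeal R) W]
    [hf : Module.Finite R (ModBy h W)] : Module.Finite R W := by
  obtain ⟨n, p, hp⟩ := Module.Finite.exists_fin' R (ModBy h W)
  obtain ⟨q, hq⟩ := Module.projective_lifting_property
    (LinearMap.range (LinearMap.lsmul R W h)).mkQ p (Submodule.mkQ_surjective _)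
  have := IsPrecomplete.pi_fin (maximalIdeal R) n
  have hle : LinearMap.range (LinearMap.lsmul R W h) ≤ maximalIdeal R • ⊤ := by
    rintro _ ⟨y, rfl⟩
    exact Submodule.smul_mem_smul hh Submodule.mem_top
  refine Module.Finite.of_surjective q
    (surjective_of_mkQ_comp_surjective (I := maximalIdeal R) ?_)
  have : (maximalIdeal R • (⊤ : Submodule R W)).mkQ ∘ₗ q = Submodule.factor hle ∘ₗ p := by
    rw [← hq]
    rfl
  rw [this]
  exact (Submodule.factor_surjective hle).comp hp

omit [IsLocalRing R] in
lemma isHausdorff_dual_of_gammaSub_eq_top (J : Ideal R) {X E : Type} [AddCommGroup X] [Module R X]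
    [AddCommGroup E] [Module R E] (hX : gammaSub J X = ⊤) : IsHausdorff J (X →ₗ[R] E) := by
  refine ⟨fun φ hφ => LinearMap.ext fun x => ?_⟩
  obtain ⟨n, hn⟩ : x ∈ gammaSub J X := hX ▸ Submodule.mem_top
  have h := SModEq.zero.1 (hφ n)
  rw [LinearMap.zero_apply]
  clear hφ
  induction h using Submodule.smul_induction_on' with
  | smul a ha ψ _ => rw [LinearMap.smul_apply, ← map_smul, hn a ha, map_zero]
  | add ψ _ χ _ h1 h2 => rw [LinearMap.add_apply, h1, h2, add_zero]

lemma supportDim_le_zero_of_isFiniteLength {X : Type} [AddCommGroup X] [Module R X]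
    (hX : IsFiniteLength R X) : Module.supportDim R X ≤ 0 := by
  have := (isFiniteLength_iff_isNoetherian_isArtinian.1 hX).1
  obtain ⟨k, hk⟩ := exists_pow_smul_eq_zero_of_fg _ (gammaSub_eq_top_of_isFiniteLength hX)
  have hsub : Subsingleton (Module.support R X) := by
    refine ⟨fun p q => ?_⟩
    have key : ∀ p : Module.support R X, p.1.asIdeal = maximalIdeal R := by
      intro p
      have hp := Module.mem_support_iff_of_finite.1 p.2
      have hle : maximalIdeal R ^ k ≤ p.1.asIdeal :=
        le_trans (fun a ha => Module.mem_annihilator.2 (hk a ha)) hp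
      exact le_antisymm (le_maximalIdeal p.1.2.ne_top) (p.1.2.le_of_pow_le hle)
    exact Subtype.ext (PrimeSpectrum.ext ((key p).trans (key q).symm))
  exact Order.krullDim_nonpos_of_subsingleton

variable [IsNoetherianRing R]

lemma supportDim_le_modBy_succ (hh : h ∈ maximalIdeal R) (W : Type) [AddCommGroup W] [Module R W]
    [Module.Finite R W] : Module.supportDim R W ≤ Module.supportDim R (ModBy h W) + 1 := by
  refine (Module.supportDim_le_supportDim_quotSMulTop_succ hh).trans (add_le_add_left ?_ _)
  refine (Module.supportDim_eq_of_equiv (Submodule.quotEquivOfEq _ _ ?_)).le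
  ext x
  simp [Submodule.mem_smul_pointwise_iff_exists]

lemma finite_dual_lcoh [IsAdicComplete (maximalIdeal R) R] [Infinite (ResidueField R)]
    {E : Type} [AddCommGroup E] [Module R E] (hE : IsInjEnvResidue R E) (j : ℕ) :
    ∀ (M : Type) [AddCommGroup M] [Module R M] [Module.Finite R M],
      Module.Finite R (LCoh (maximalIdeal R) j M →ₗ[R] E) ∧
        Module.supportDim R (LCoh (maximalIdeal R) j M →ₗ[R] E) ≤ j := by
  have := hE.1
  have hm : MPrimary (maximalIdeal R) := ⟨le_rfl, 1, (pow_one _).le⟩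
  induction j with
  | zero =>
    intro M _ _ _
    have hl : IsFiniteLength R (LCoh (maximalIdeal R) 0 M →ₗ[R] E) := by
      rw [← Module.length_ne_top_iff, length_dual_lcoh_zero hE, Module.length_ne_top_iff]
      exact isFiniteLength_gammaSub M
    have := (isFiniteLength_iff_isNoetherian_isArtinian.1 hl).1
    exact ⟨inferInstance, supportDim_le_zero_of_isFiniteLength hl⟩
  | succ j ih =>
    intro M _ _ _
    obtain ⟨x, hx, hs⟩ := (generic_superficialOn (maximalIdeal R) M).exists
    obtain ⟨f, -, hf, -⟩ := exists_dual_modBy_exact (maximalIdeal R) E (hs.gammaSub_ker hm) j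
    obtain ⟨h1, h2⟩ := ih (ModBy x M)
    have h3 : Module.Finite R (ModBy x (LCoh (maximalIdeal R) (j + 1) M →ₗ[R] E)) :=
      Module.Finite.of_injective f hf
    have h4 : IsHausdorff (maximalIdeal R) (LCoh (maximalIdeal R) (j + 1) M →ₗ[R] E) :=
      isHausdorff_dual_of_gammaSub_eq_top _ (gammaSub_lcoh_eq_top _ _ _)
    have h5 := finite_of_finite_modBy hx (LCoh (maximalIdeal R) (j + 1) M →ₗ[R] E)
    refine ⟨h5, (supportDim_le_modBy_succ hx _).trans ?_⟩
    rw [Nat.cast_add, Nat.cast_one]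
    exact add_le_add_left ((Module.supportDim_le_of_injective f hf).trans h2) 1

omit [IsLocalRing R] [IsNoetherianRing R] in
lemma mDim_eq_supportDim (M : Type) [AddCommGroup M] [Module R M] [Module.Finite R M] :
    mDim R M = Module.supportDim R M := by
  rw [Module.supportDim_eq_ringKrullDim_quotient_annihilator, mDim, Submodule.annihilator_top]

lemma HDegRel.exists_HD [IsAdicComplete (maximalIdeal R) R] [Infinite (ResidueField R)]
    {E : Type} [AddCommGroup E] [Module R E] (hE : IsInjEnvResidue R E) {Q : Ideal R}
    (hQ : MPrimary Q) {M : ModuleCat R} {v : ℕ} (hv : HDegRel R Q E M v) (hM : Module.Finite R M)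
    {d : ℕ} (hd : Module.supportDim R M ≤ d) : ∃ r ≤ d, HD Q E r M v := by
  induction hv generalizing d with
  | base M l _ hl => exact ⟨0, Nat.zero_le _, .zero _ _ ((mLength_eq_coe_iff l).1 hl).le⟩
  | step M r hr hr0 e e0 he he0 v hv ih =>
    obtain ⟨r, rfl⟩ : ∃ k, r = k + 1 := ⟨r - 1, by omega⟩
    rw [← mDim_eq_supportDim, hr] at hd
    have key : ∀ j, ∃ s ≤ j, j < r + 1 →
        HD Q E s (ModuleCat.of R (LCoh (maximalIdeal R) j M →ₗ[R] E)) (v j) := by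
      intro j
      by_cases hj : j < r + 1
      · obtain ⟨h1, h2⟩ := finite_dual_lcoh hE j M
        obtain ⟨s, hs, h⟩ := ih j hj h1 h2
        exact ⟨s, hs, fun _ => h⟩
      · exact ⟨0, Nat.zero_le _, fun h => absurd h hj⟩
    choose s hs hHD using key
    exact ⟨r + 1, by exact_mod_cast hd, .succ _ r e0 _ s v hM (he.growthLE hQ (by omega) he0)
      (fun j _ => hs j) (fun j hj => hHD j (Nat.lt_succ_of_le hj)) le_rfl⟩

end Finiteness

theorem statement19 (R : Type) [CommRing R] [IsLocalRing R] [IsNoetherianRing R]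
    [IsAdicComplete (maximalIdeal R) R]
    (hres : Infinite (IsLocalRing.ResidueField R))
    (M : Type) [AddCommGroup M] [Module R M] [Module.Finite R M]
    (d : ℕ) (hd : mDim R M = (d : ℕ∞)) (hdR : mDim R M = ringKrullDim R)
    (hd1 : 1 ≤ d)
    (x : Fin d → R) (hx : IsParamIdeal R (Ideal.span (Set.range x)) R d)
    (l : ℕ)
    (hl : mLength R
      (M ⧸ (Ideal.span (Set.range x) • (⊤ : Submodule R M))) = (l : ℕ∞))
    (e : ℕ → ℤ) (he : HasHilbCoeffs R (Ideal.span (Set.range x)) M d e)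
    (E : Type) [AddCommGroup E] [Module R E] (hE : IsInjEnvResidue R E)
    (v : ℕ) (hv : HDegRel R (Ideal.span (Set.range x)) E (ModuleCat.of R M) v) :
    (l : ℤ) - e 0 ≤ (v : ℤ) - e 0 := by
  have hQ : MPrimary (Ideal.span (Set.range x)) := by
    refine mPrimary_of_isFiniteLength hx.1 ?_
    have h := hx.2.2
    rwa [smul_eq_mul, Ideal.mul_top] at h
  have hdim : Module.supportDim R (ModuleCat.of R M) ≤ d :=
    (mDim_eq_supportDim M).symm.trans hd |>.le
  obtain ⟨r, -, h⟩ := hv.exists_HD hE hQ ‹Module.Finite R M› hdim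
  have hle := h.length_quotient_le hE hQ
  change Module.length R (M ⧸ (Ideal.span (Set.range x) • (⊤ : Submodule R M))) ≤ _ at hle
  rw [(mLength_eq_coe_iff l).1 hl, Nat.cast_le] at hle
  omega
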